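/- Let f, g_1, …, g_m ∈ ℝ[x] with g = (g_1,…,g_m). Assume that f is non-negative on S(g) and that the image f(C⁺(g)) := {f(x) : x ∈ C⁺(g)} is a finite set. Then there exists q ∈ P(g)[x, λ̄] such that f − q vanishes on V(h_FJ⁺). Moreover, if S(g) satisfies the Archimedean condition, one can take q ∈ Q(g)[x, λ̄]. -/

import Mathlib

open MvPolynomial

noncomputable section

/-- `p` is a sum of squares of polynomials. -/
def IsSOS {σ : Type*} (p : MvPolynomial σ ℝ) : Prop :=
  ∃ (k : ℕ) (q : Fin k → MvPolynomial σ ℝ), p = ∑ i, q i ^ 2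

/-- Membership in the quadratic module `Q(g)` generated by the tuple `g`. -/
def InQM {σ ι : Type*} [Fintype ι] (g : ι → MvPolynomial σ ℝ) (p : MvPolynomial σ ℝ) : Prop :=
  ∃ (s0 : MvPolynomial σ ℝ) (s : ι → MvPolynomial σ ℝ),
    IsSOS s0 ∧ (∀ j, IsSOS (s j)) ∧ p = s0 + ∑ j, s j * g j

/-- Membership in the preordering `P(g)` generated by the tuple `g`. -/
def InPre {σ ι : Type*} [Fintype ι] [DecidableEq ι] (g : ι → MvPolynomial σ ℝ)
    (p : MvPolynomial σ ℝ) : Prop :=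
  ∃ s : Finset ι → MvPolynomial σ ℝ, (∀ A, IsSOS (s A)) ∧
    p = ∑ A : Finset ι, s A * ∏ j ∈ A, g j

/-- The basic semi-algebraic set `S(g)`. -/
def Sg {n m : ℕ} (g : Fin m → MvPolynomial (Fin n) ℝ) : Set (Fin n → ℝ) :=
  {x | ∀ j, 0 ≤ eval x (g j)}

/-- `S(g)` satisfies the Archimedean condition. -/
def ArchCond {n m : ℕ} (g : Fin m → MvPolynomial (Fin n) ℝ) : Prop :=
  ∃ R : ℝ, 0 < R ∧ InQM g (C R - ∑ i : Fin n, X i ^ 2)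

/-- The set of critical points `C⁺(g)` (non-negative multipliers, written as squares). -/
def CplusSet {n m : ℕ} (g : Fin m → MvPolynomial (Fin n) ℝ) : Set (Fin n → ℝ) :=
  {x | ∃ lam : Fin m → ℝ, (∑ j, lam j ^ 2 = 1) ∧
    (∀ i, ∑ j, lam j ^ 2 * eval x (pderiv i (g j)) = 0) ∧
    (∀ j, lam j ^ 2 * eval x (g j) = 0)}

/-- The real variety `V(h_FJ⁺)` of the Fritz John system with squared multipliers. -/
def VFJplus {n m : ℕ} (f : MvPolynomial (Fin n) ℝ) (g : Fin m → MvPolynomial (Fin n) ℝ) :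
    Set ((Fin n → ℝ) × (Fin (m + 1) → ℝ)) :=
  {p | (∀ i, p.2 0 ^ 2 * eval p.1 (pderiv i f)
        = ∑ j, p.2 j.succ ^ 2 * eval p.1 (pderiv i (g j)))
    ∧ (∀ j, p.2 j.succ ^ 2 * eval p.1 (g j) = 0)
    ∧ (∑ j, p.2 j ^ 2 = 1)}

open scoped TensorProduct in
/-- In characteristic zero, an element of a finitely generated field extension with vanishing
differential is algebraic. -/
theorem isAlgebraic_of_kaehlerDifferential_eq_zero {F K : Type*} [Field F] [CharZero F] [Field K]
    [Algebra F K] [Algebra.EssFiniteType F K] (x : K) (hx : KaehlerDifferential.D F K x = 0) :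
    IsAlgebraic F x := by
  by_contra htr
  have hinj : Function.Injective (Polynomial.aeval (R := F) x) :=
    transcendental_iff_injective.mp htr
  let : Algebra (Polynomial F) K := (Polynomial.aeval (R := F) x).toRingHom.toAlgebra
  have halg : ∀ p : Polynomial F, algebraMap (Polynomial F) K p = Polynomial.aeval x p :=
    fun _ => rfl
  have : IsScalarTower F (Polynomial F) K := IsScalarTower.of_algebraMap_eq (by
    intro r; rw [halg]; simp)
  have : FaithfulSMul (Polynomial F) K := (faithfulSMul_iff_algebraMap_injective _ _).mpr hinj
  let E := FractionRing (Polynomial F)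
  let : Algebra E K := FractionRing.liftAlgebra (Polynomial F) K
  have : IsScalarTower (Polynomial F) E K := inferInstance
  have : IsScalarTower F E K := IsScalarTower.of_algebraMap_eq (by
    intro r
    rw [IsScalarTower.algebraMap_apply F (Polynomial F) E,
      ← IsScalarTower.algebraMap_apply (Polynomial F) E K, ← IsScalarTower.algebraMap_apply])
  have : CharZero E := charZero_of_injective_algebraMap (FaithfulSMul.algebraMap_injective F E)
  have : Algebra.EssFiniteType E K := Algebra.EssFiniteType.of_comp F E K
  have : Algebra.FormallySmooth (Polynomial F) E :=
    .of_isLocalization (nonZeroDivisors (Polynomial F))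
  have : Algebra.FormallySmooth E K := inferInstance
  have : Algebra.FormallySmooth (Polynomial F) K := .comp _ E K
  have h0 : KaehlerDifferential.mapBaseChange F (Polynomial F) K
      (1 ⊗ₜ KaehlerDifferential.D F (Polynomial F) Polynomial.X) = 0 := by
    simp [KaehlerDifferential.mapBaseChange_tmul, halg, hx]
  obtain ⟨y, hy⟩ := (Algebra.H1Cotangent.exact_δ_mapBaseChange F (Polynomial F) K _).mp h0
  have hy0 : y = 0 := Subsingleton.elim _ _
  rw [hy0, map_zero] at hy
  let e := (KaehlerDifferential.polynomialEquiv F).toLinearMap.lTensor K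
  have h1 := congrArg (fun z => TensorProduct.rid (Polynomial F) K (e z)) hy
  simp [e] at h1

theorem MvPolynomial.derivation_aeval {σ F K M : Type*} [Fintype σ] [CommRing F] [CommRing K]
    [Algebra F K] [AddCommGroup M] [Module F M] [Module K M] [IsScalarTower F K M]
    (D : Derivation F K M) (y : σ → K)
    (p : MvPolynomial σ F) :
    D (aeval y p) = ∑ i, aeval y (pderiv i p) • D (y i) := by
  classical
  induction p using MvPolynomial.induction_on with
  | C a => simp
  | add p q hp hq => simp [hp, hq, add_smul, Finset.sum_add_distrib]
  | mul_X p i hp =>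
    simp only [map_mul, Derivation.leibniz, hp, aeval_X, pderiv_X, smul_eq_mul, map_add, add_smul,
      Finset.sum_add_distrib, Finset.smul_sum, smul_smul]
    congr 1
    rw [Finset.sum_eq_single i]
    · simp
    · intro b _ hb
      simp [hb.symm]
    · simp

/-- At a generic point of the Fritz John system whose leading multiplier is nonzero, the objective
is algebraic over the base field. -/
theorem isAlgebraic_aeval_of_fritzJohn {n m : ℕ} {F K : Type*} [Field F] [CharZero F] [Field K]
    [Algebra F K] [Algebra.EssFiniteType F K] (f : MvPolynomial (Fin n) F)
    (g : Fin m → MvPolynomial (Fin n) F) (y : Fin n → K) (l : Fin (m + 1) → K) (hl : l 0 ≠ 0)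
    (hgrad : ∀ i, l 0 ^ 2 * aeval y (pderiv i f)
      = ∑ j, l (Fin.succ j) ^ 2 * aeval y (pderiv i (g j)))
    (hcompl : ∀ j : Fin m, l j.succ ^ 2 * aeval y (g j) = 0) :
    IsAlgebraic F (aeval y f) := by
  apply isAlgebraic_of_kaehlerDifferential_eq_zero
  have key : l 0 ^ 2 • KaehlerDifferential.D F K (aeval y f) = 0 := by
    rw [derivation_aeval, Finset.smul_sum]
    simp_rw [smul_smul, hgrad, Finset.sum_smul]
    rw [Finset.sum_comm]
    refine Finset.sum_eq_zero fun j _ => ?_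
    simp_rw [← smul_smul]
    rw [← Finset.smul_sum, ← derivation_aeval]
    rcases mul_eq_zero.mp (hcompl j) with h | h
    · rw [h, zero_smul]
    · rw [h, map_zero, smul_zero]
  exact (smul_eq_zero.mp key).resolve_left (pow_ne_zero 2 hl)

/-- The polynomials cutting out `VFJplus f g`. -/
def fjPoly {n m : ℕ} (f : MvPolynomial (Fin n) ℝ) (g : Fin m → MvPolynomial (Fin n) ℝ) :
    Fin n ⊕ Fin m ⊕ Unit → MvPolynomial (Fin n ⊕ Fin (m + 1)) ℝ
  | .inl i => X (.inr 0) ^ 2 * rename .inl (pderiv i f)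
      - ∑ j : Fin m, X (.inr j.succ) ^ 2 * rename .inl (pderiv i (g j))
  | .inr (.inl j) => X (.inr j.succ) ^ 2 * rename .inl (g j)
  | .inr (.inr _) => 1 - ∑ j, X (.inr j) ^ 2

theorem eval_elim_rename_inl {σ τ : Type*} (x : σ → ℝ) (l : τ → ℝ) (p : MvPolynomial σ ℝ) :
    eval (Sum.elim x l) (rename Sum.inl p) = eval x p := by
  rw [eval_rename, Sum.elim_comp_inl]

theorem mem_VFJplus_iff {n m : ℕ} (f : MvPolynomial (Fin n) ℝ)
    (g : Fin m → MvPolynomial (Fin n) ℝ) (p : (Fin n → ℝ) × (Fin (m + 1) → ℝ)) :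
    p ∈ VFJplus f g ↔ ∀ k, eval (Sum.elim p.1 p.2) (fjPoly f g k) = 0 := by
  simp only [VFJplus, Set.mem_ofPred_eq, Sum.forall, fjPoly, map_sub, map_mul, map_sum, map_pow,
    eval_X, Sum.elim_inr, eval_elim_rename_inl, map_one, sub_eq_zero, forall_const]
  rw [eq_comm (a := (1 : ℝ))]

theorem finite_image_VFJplus {n m : ℕ} (f : MvPolynomial (Fin n) ℝ)
    (g : Fin m → MvPolynomial (Fin n) ℝ)
    (hfin : ((fun x => eval x f) '' CplusSet g).Finite) :
    ((fun p : (Fin n → ℝ) × (Fin (m + 1) → ℝ) => eval p.1 f) '' VFJplus f g).Finite := by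
  set I : Ideal (MvPolynomial (Fin n ⊕ Fin (m + 1)) ℝ) := Ideal.span (Set.range (fjPoly f g))
    with hI
  have hmin : I.minimalPrimes.Finite := I.finite_minimalPrimes_of_isNoetherianRing
  have hgen : ∀ P ∈ I.minimalPrimes, X (Sum.inr 0) ∉ P →
      ∃ c : Polynomial ℝ, c ≠ 0 ∧ Polynomial.aeval (rename Sum.inl f) c ∈ P := by
    intro P hP hX
    have hprime : P.IsPrime := hP.1.1
    let B := MvPolynomial (Fin n ⊕ Fin (m + 1)) ℝ ⧸ P
    let K := FractionRing B
    let φ : MvPolynomial (Fin n ⊕ Fin (m + 1)) ℝ →ₐ[ℝ] K :=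
      (IsScalarTower.toAlgHom ℝ B K).comp (Ideal.Quotient.mkₐ ℝ P)
    have hφ : ∀ p, φ p = 0 ↔ p ∈ P := by
      intro p
      change algebraMap B K (Ideal.Quotient.mk P p) = 0 ↔ _
      rw [map_eq_zero_iff _ (IsFractionRing.injective B K), Ideal.Quotient.eq_zero_iff_mem]
    have hker : ∀ k, φ (fjPoly f g k) = 0 := fun k =>
      (hφ _).2 (hP.1.2 (Ideal.subset_span ⟨k, rfl⟩))
    have hren : ∀ p : MvPolynomial (Fin n) ℝ,
        φ (rename Sum.inl p) = aeval (fun i => φ (X (Sum.inl i))) p := by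
      intro p
      have : φ.comp (rename Sum.inl) = aeval (fun i => φ (X (Sum.inl i))) := by
        ext i; simp
      exact DFunLike.congr_fun this p
    have : Algebra.EssFiniteType B K := .of_isLocalization _ (nonZeroDivisors B)
    have : Algebra.EssFiniteType ℝ K := .comp ℝ B K
    have halg : IsAlgebraic ℝ (aeval (fun i => φ (X (Sum.inl i))) f) := by
      apply isAlgebraic_aeval_of_fritzJohn f g _ (fun j => φ (X (Sum.inr j)))
      · exact fun h => hX ((hφ _).1 h)
      · intro i
        have := hker (.inl i)
        simp only [fjPoly, map_sub, map_mul, map_sum, map_pow, hren] at this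
        exact sub_eq_zero.1 this
      · intro j
        have := hker (.inr (.inl j))
        simpa only [fjPoly, map_mul, map_pow, hren] using this
    obtain ⟨c, hc, hc0⟩ := halg
    refine ⟨c, hc, (hφ _).1 ?_⟩
    rw [← hren, Polynomial.aeval_algHom_apply] at hc0
    exact hc0
  choose! c hc0 hcP using hgen
  refine (hfin.union (hmin.biUnion fun P _ => ((c P).roots.toFinset.finite_toSet))).subset ?_
  rintro _ ⟨p, hp, rfl⟩
  by_cases h0 : p.2 0 = 0
  · left
    refine ⟨p.1, ⟨fun j => p.2 j.succ, ?_, ?_, hp.2.1⟩, rfl⟩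
    · have := hp.2.2
      rw [Fin.sum_univ_succ, h0] at this
      simpa using this
    · intro i
      rw [← hp.1 i, h0]; simp
  · right
    have hle : I ≤ RingHom.ker (eval (Sum.elim p.1 p.2)) := by
      rw [hI, Ideal.span_le]
      rintro _ ⟨k, rfl⟩
      exact (mem_VFJplus_iff f g p).1 hp k
    have := RingHom.ker_isPrime (eval (Sum.elim p.1 p.2))
    obtain ⟨P, hP, hPle⟩ := Ideal.exists_minimalPrimes_le hle
    have hX : X (Sum.inr 0) ∉ P := fun h => h0 (by simpa using hPle h)
    refine Set.mem_biUnion hP ?_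
    have hroot := hPle (hcP P hP hX)
    rw [RingHom.mem_ker] at hroot
    simp only [Finset.mem_coe, Multiset.mem_toFinset, Polynomial.mem_roots (hc0 P hP hX),
      Polynomial.IsRoot.def]
    have h2 := Polynomial.hom_eval₂ (c P) (algebraMap ℝ _) (eval (Sum.elim p.1 p.2))
      (rename Sum.inl f)
    rw [← Polynomial.aeval_def, hroot, eval_elim_rename_inl] at h2
    rw [Polynomial.eval, h2]
    congr 1
    ext r
    simp

/-- The intermediate value property for polynomials over an ordered field. -/
def PolyIVT (R : Type*) [Field R] [LinearOrder R] : Prop :=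
  ∀ (p : Polynomial R) (a b : R), a < b → p.eval a * p.eval b < 0 →
    ∃ c, a < c ∧ c < b ∧ p.eval c = 0

namespace PolyIVT

variable {R : Type*} [Field R] [LinearOrder R] [IsStrictOrderedRing R]

theorem eval_mul_eval_pos (hR : PolyIVT R) {p : Polynomial R} {a b : R} (hab : a ≤ b)
    (hp : ∀ c, a ≤ c → c ≤ b → p.eval c ≠ 0) : 0 < p.eval a * p.eval b := by
  rcases hab.eq_or_lt with rfl | hab
  · exact mul_self_pos.2 (hp _ le_rfl le_rfl)
  rcases lt_trichotomy (p.eval a * p.eval b) 0 with h | h | h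
  · obtain ⟨c, h1, h2, h3⟩ := hR p a b hab h
    exact absurd h3 (hp c h1.le h2.le)
  · rcases mul_eq_zero.1 h with h | h
    · exact absurd h (hp a le_rfl hab.le)
    · exact absurd h (hp b hab.le le_rfl)
  · exact h

theorem exists_derivative_eval_eq_zero (hR : PolyIVT R) {p : Polynomial R} {a b : R} (hab : a < b)
    (ha : p.eval a = 0) (hb : p.eval b = 0) :
    ∃ c, a < c ∧ c < b ∧ p.derivative.eval c = 0 := by
  classical
  by_cases hp : p = 0
  · obtain ⟨c, h1, h2⟩ := exists_between hab
    exact ⟨c, h1, h2, by simp [hp]⟩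
  -- replace `b` by the smallest root above `a`
  obtain ⟨b', hb', hmin⟩ := (p.roots.toFinset.filter (a < ·)).exists_min_image id
    ⟨b, by simp [hp, hb, hab]⟩
  simp only [Finset.mem_filter, Multiset.mem_toFinset, Polynomial.mem_roots hp,
    Polynomial.IsRoot.def, id] at hb' hmin
  have hb'b : b' ≤ b := hmin b ⟨hb, hab⟩
  suffices ∃ c, a < c ∧ c < b' ∧ p.derivative.eval c = 0 by
    obtain ⟨c, h1, h2, h3⟩ := this
    exact ⟨c, h1, h2.trans_le hb'b, h3⟩
  obtain ⟨hb0, hab'⟩ := hb'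
  obtain ⟨q, hq, hqa⟩ := Polynomial.exists_eq_pow_rootMultiplicity_mul_and_not_dvd p hp a
  have hm : p.rootMultiplicity a ≠ 0 := by
    rw [← Nat.pos_iff_ne_zero, Polynomial.rootMultiplicity_pos hp]; exact ha
  obtain ⟨m, hm⟩ := Nat.exists_eq_succ_of_ne_zero hm
  rw [hm] at hq
  have hq0 : q ≠ 0 := by rintro rfl; simp at hqa
  have hqb : q.eval b' = 0 := by
    rw [hq] at hb0
    simpa [sub_eq_zero, hab'.ne'] using hb0
  obtain ⟨r, hr, hrb⟩ := Polynomial.exists_eq_pow_rootMultiplicity_mul_and_not_dvd q hq0 b'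
  have hn : q.rootMultiplicity b' ≠ 0 := by
    rw [← Nat.pos_iff_ne_zero, Polynomial.rootMultiplicity_pos hq0]; exact hqb
  obtain ⟨n, hn⟩ := Nat.exists_eq_succ_of_ne_zero hn
  rw [hn] at hr
  rw [Polynomial.dvd_iff_isRoot, Polynomial.IsRoot.def] at hqa hrb
  have hra : r.eval a ≠ 0 := by
    intro h; apply hqa; rw [hr]; simp [h]
  have hrpos : 0 < r.eval a * r.eval b' := by
    refine hR.eval_mul_eval_pos hab'.le fun c h1 h2 h0 => ?_
    rcases h1.eq_or_lt with rfl | h1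
    · exact hra h0
    rcases h2.eq_or_lt with rfl | h2
    · exact hrb h0
    have := hmin c ⟨by rw [hq, hr]; simp [h0], h1⟩
    exact absurd h2 this.not_gt
  set s : Polynomial R := ((m + 1 : ℕ) : Polynomial R) * (Polynomial.X - Polynomial.C b') * r
    + ((n + 1 : ℕ) : Polynomial R) * (Polynomial.X - Polynomial.C a) * r
    + (Polynomial.X - Polynomial.C a) * (Polynomial.X - Polynomial.C b') * r.derivative with hs
  have hder : p.derivative = (Polynomial.X - Polynomial.C a) ^ m
      * (Polynomial.X - Polynomial.C b') ^ n * s := by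
    rw [hq, hr, hs]
    simp only [Nat.succ_eq_add_one, Polynomial.derivative_mul, Polynomial.derivative_pow_succ,
      Polynomial.derivative_sub, Polynomial.derivative_X, Polynomial.derivative_C, sub_zero,
      mul_one, map_add, map_natCast, map_one]
    push_cast
    ring
  have hsa : s.eval a = (m + 1 : ℕ) * (a - b') * r.eval a := by simp [hs]
  have hsb : s.eval b' = (n + 1 : ℕ) * (b' - a) * r.eval b' := by simp [hs]
  have hneg : s.eval a * s.eval b' < 0 := by
    have : s.eval a * s.eval b' = -(((m + 1 : ℕ) : R) * (n + 1 : ℕ) * (b' - a) ^ 2 *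
      (r.eval a * r.eval b')) := by rw [hsa, hsb]; ring
    rw [this, neg_lt_zero]
    have : 0 < b' - a := sub_pos.2 hab'
    positivity
  obtain ⟨c, h1, h2, h3⟩ := hR s a b' hab' hneg
  exact ⟨c, h1, h2, by rw [hder]; simp [h3]⟩

theorem exists_eval_sub_eval_eq (hR : PolyIVT R) (p : Polynomial R) {a b : R} (hab : a < b) :
    ∃ c, a < c ∧ c < b ∧ p.eval b - p.eval a = p.derivative.eval c * (b - a) := by
  obtain ⟨c, h1, h2, h3⟩ := hR.exists_derivative_eval_eq_zero (p := p * Polynomial.C (b - a)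
    - Polynomial.C (p.eval b - p.eval a) * (Polynomial.X - Polynomial.C a)
    - Polynomial.C (p.eval a * (b - a))) hab (by simp) (by simp; ring)
  refine ⟨c, h1, h2, ?_⟩
  simp [Polynomial.derivative_mul] at h3
  linear_combination -h3

theorem eval_mul_eval_neg_of_root (hR : PolyIVT R) {p : Polynomial R} {a t b : R} (hat : a < t)
    (htb : t < b) (ht : p.eval t = 0)
    (hp : ∀ c, a < c → c < b → p.derivative.eval c ≠ 0) : p.eval a * p.eval b < 0 := by
  obtain ⟨c, h1, h2, h3⟩ := hR.exists_eval_sub_eval_eq p hat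
  obtain ⟨d, h4, h5, h6⟩ := hR.exists_eval_sub_eval_eq p htb
  have h7 := hR.eval_mul_eval_pos (p := p.derivative) (h2.trans h4).le
    fun e he he' => hp e (h1.trans_le he) (he'.trans_lt h5)
  have h8 : p.eval a = -(p.derivative.eval c * (t - a)) := by linear_combination -h3 + ht
  have h9 : p.eval b = p.derivative.eval d * (b - t) := by linear_combination h6 + ht
  have h10 : p.eval a * p.eval b
      = -((p.derivative.eval c * p.derivative.eval d) * ((t - a) * (b - t))) := by
    rw [h8, h9]; ring
  rw [h10, neg_lt_zero]
  exact mul_pos h7 (mul_pos (sub_pos.2 hat) (sub_pos.2 htb))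

end PolyIVT

theorem polyIVT_real : PolyIVT ℝ := by
  intro p a b hab h
  have hc : ContinuousOn (fun x => p.eval x) (Set.Icc a b) := p.continuous.continuousOn
  rcases mul_neg_iff.1 h with ⟨h1, h2⟩ | ⟨h1, h2⟩
  · obtain ⟨c, hc, h0⟩ := intermediate_value_Ioo' hab.le hc ⟨h2, h1⟩
    exact ⟨c, hc.1, hc.2, h0⟩
  · obtain ⟨c, hc, h0⟩ := intermediate_value_Ioo hab.le hc ⟨h1, h2⟩
    exact ⟨c, hc.1, hc.2, h0⟩

theorem Filter.Germ.exists_polynomial_family {α : Type*} (U : Ultrafilter α)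
    (p : Polynomial (Filter.Germ (U : Filter α) ℝ)) :
    ∃ P : α → Polynomial ℝ, ∀ x : α → ℝ,
      p.eval (x : Filter.Germ (U : Filter α) ℝ) = ((fun i => (P i).eval (x i) : α → ℝ) :
        Filter.Germ (U : Filter α) ℝ) := by
  induction p using Polynomial.induction_on' with
  | add p q hp hq =>
    obtain ⟨P, hP⟩ := hp
    obtain ⟨Q, hQ⟩ := hq
    refine ⟨fun i => P i + Q i, fun x => ?_⟩
    rw [Polynomial.eval_add, hP, hQ, ← Filter.Germ.coe_add]
    congr 1
    ext i
    simp
  | monomial n a =>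
    induction a using Filter.Germ.inductionOn with
    | h c =>
    refine ⟨fun i => Polynomial.monomial n (c i), fun x => ?_⟩
    rw [Polynomial.eval_monomial, ← Filter.Germ.coe_pow, ← Filter.Germ.coe_mul]
    congr 1
    ext i
    simp

theorem polyIVT_germ {α : Type*} (U : Ultrafilter α) :
    PolyIVT (Filter.Germ (U : Filter α) ℝ) := by
  intro p a b
  induction a using Filter.Germ.inductionOn with
  | h a =>
  induction b using Filter.Germ.inductionOn with
  | h b =>
  intro hab h
  obtain ⟨P, hP⟩ := Filter.Germ.exists_polynomial_family U p
  rw [hP, hP, ← Filter.Germ.coe_mul, ← Filter.Germ.coe_zero, Filter.Germ.coe_lt] at h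
  rw [Filter.Germ.coe_lt] at hab
  have : ∀ i, ∃ c : ℝ, a i < b i → (P i).eval (a i) * (P i).eval (b i) < 0 →
      a i < c ∧ c < b i ∧ (P i).eval c = 0 := by
    intro i
    by_cases h1 : a i < b i ∧ (P i).eval (a i) * (P i).eval (b i) < 0
    · obtain ⟨c, hc⟩ := polyIVT_real (P i) _ _ h1.1 h1.2
      exact ⟨c, fun _ _ => hc⟩
    · exact ⟨0, fun h2 h3 => absurd ⟨h2, h3⟩ h1⟩
  choose c hc using this
  have hall : ∀ᶠ i in (U : Filter α), a i < c i ∧ c i < b i ∧ (P i).eval (c i) = 0 := by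
    filter_upwards [hab, h] with i h1 h2
    exact hc i h1 h2
  refine ⟨c, ?_, ?_, ?_⟩
  · exact Filter.Germ.coe_lt.2 (hall.mono fun i h => h.1)
  · exact Filter.Germ.coe_lt.2 (hall.mono fun i h => h.2.1)
  · rw [hP, ← Filter.Germ.coe_zero, Filter.Germ.coe_eq]
    exact hall.mono fun i h => h.2.2

/-- Two ring homomorphisms into ordered rings that give the same sign to every element. -/
def SignCompat {G R₁ R₂ : Type*} [CommRing G] [Field R₁] [LinearOrder R₁] [Field R₂]
    [LinearOrder R₂] (i₁ : G →+* R₁) (i₂ : G →+* R₂) : Prop :=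
  ∀ g, 0 < i₁ g ↔ 0 < i₂ g

theorem SignCompat.symm {G R₁ R₂ : Type*} [CommRing G] [Field R₁] [LinearOrder R₁] [Field R₂]
    [LinearOrder R₂] {i₁ : G →+* R₁} {i₂ : G →+* R₂} (h : SignCompat i₁ i₂) :
    SignCompat i₂ i₁ := fun g => (h g).symm

namespace SignCompat

variable {G R₁ R₂ : Type*} [CommRing G] [Field R₁] [LinearOrder R₁] [IsStrictOrderedRing R₁]
  [Field R₂] [LinearOrder R₂] [IsStrictOrderedRing R₂] {i₁ : G →+* R₁} {i₂ : G →+* R₂}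

theorem neg_iff (h : SignCompat i₁ i₂) (g : G) : i₁ g < 0 ↔ i₂ g < 0 := by
  simpa using h (-g)

theorem eq_zero_iff (h : SignCompat i₁ i₂) (g : G) : i₁ g = 0 ↔ i₂ g = 0 := by
  have h1 := h g
  have h2 := h.neg_iff g
  rw [← not_iff_not, ← ne_eq, ← ne_eq, ne_iff_lt_or_gt, ne_iff_lt_or_gt, h1, h2]

theorem lt_iff (h : SignCompat i₁ i₂) (a b : G) : i₁ a < i₁ b ↔ i₂ a < i₂ b := by
  simpa [sub_pos] using h (b - a)

theorem map_eq_zero_iff (h : SignCompat i₁ i₂) (q : Polynomial G) :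
    q.map i₁ = 0 ↔ q.map i₂ = 0 := by
  simp [Polynomial.ext_iff, h.eq_zero_iff]

end SignCompat

theorem Polynomial.abs_lt_of_monic_of_eval₂_eq_zero {G R : Type*} [CommRing G] [Field R]
    [LinearOrder R] [IsStrictOrderedRing R] (i : G →+* R) {p : Polynomial G} (hp : p.Monic) {t : R}
    (hd : p.natDegree ≠ 0) (ht : p.eval₂ i t = 0) :
    |t| < i (1 + ∑ k ∈ Finset.range p.natDegree, (1 + p.coeff k ^ 2)) := by
  obtain ⟨d, hd⟩ := Nat.exists_eq_succ_of_ne_zero hd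
  have hlt : ∑ k ∈ Finset.range p.natDegree, |i (p.coeff k)|
      < i (1 + ∑ k ∈ Finset.range p.natDegree, (1 + p.coeff k ^ 2)) := by
    rw [map_add, map_sum, map_one]
    have : ∑ k ∈ Finset.range p.natDegree, |i (p.coeff k)|
        ≤ ∑ k ∈ Finset.range p.natDegree, i (1 + p.coeff k ^ 2) := by
      refine Finset.sum_le_sum fun k _ => ?_
      rw [map_add, map_one, map_pow, ← sq_abs]
      nlinarith [sq_nonneg (|i (p.coeff k)| - 1), abs_nonneg (i (p.coeff k))]
    linarith
  rcases le_or_gt |t| 1 with h1 | h1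
  · refine h1.trans_lt ?_
    have : 0 ≤ ∑ k ∈ Finset.range d, (1 + i (p.coeff k) ^ 2) :=
      Finset.sum_nonneg fun k _ => by positivity
    simp only [map_add, map_sum, map_one, map_pow, hd, Finset.sum_range_succ, Nat.succ_eq_add_one]
    nlinarith [sq_nonneg (i (p.coeff d))]
  · refine lt_of_le_of_lt ?_ hlt
    have h2 : t ^ p.natDegree = -∑ k ∈ Finset.range p.natDegree, i (p.coeff k) * t ^ k := by
      rw [hp.as_sum] at ht
      simp only [Polynomial.eval₂_add, Polynomial.eval₂_X_pow, Polynomial.eval₂_finsetSum,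
        Polynomial.eval₂_mul, Polynomial.eval₂_C] at ht
      linear_combination ht
    have h3 : |t| ^ p.natDegree ≤ ∑ k ∈ Finset.range p.natDegree, |i (p.coeff k)| * |t| ^ d := by
      rw [← abs_pow, h2, abs_neg]
      refine (Finset.abs_sum_le_sum_abs _ _).trans (Finset.sum_le_sum fun k hk => ?_)
      rw [abs_mul, abs_pow]
      gcongr
      · exact h1.le
      · rw [hd, Finset.mem_range] at hk; omega
    rw [← Finset.sum_mul] at h3
    have h4 : |t| * |t| ^ d ≤ (∑ k ∈ Finset.range p.natDegree, |i (p.coeff k)|) * |t| ^ d := by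
      rw [← pow_succ']; simpa only [hd] using h3
    exact le_of_mul_le_mul_right h4 (pow_pos (zero_lt_one.trans h1) d)

theorem lt_map_midpoint {G R : Type*} [CommRing G] [Field R] [LinearOrder R]
    [IsStrictOrderedRing R] (i : G →+* R) {a b e : G} (he : e * 2 = 1) (h : i a < i b) :
    i a < i ((a + b) * e) ∧ i ((a + b) * e) < i b := by
  have he' : i e = 2⁻¹ := by
    refine eq_inv_of_mul_eq_one_left ?_
    rw [← map_ofNat i 2, ← map_mul, he, map_one]
  rw [map_mul, map_add, he', ← div_eq_mul_inv]
  constructor <;> linarith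

theorem PolyIVT.eval₂_pos_iff {G R : Type*} [CommRing G] [Field R] [LinearOrder R]
    [IsStrictOrderedRing R] (hR : PolyIVT R) (i : G →+* R) {a b : R} {q : Polynomial G}
    (hn : ∀ c, a < c → c < b → q.eval₂ i c ≠ 0) (x y : R)
    (hx : a < x) (hx' : x < b) (hy : a < y) (hy' : y < b) :
    0 < q.eval₂ i x ↔ 0 < q.eval₂ i y := by
  rw [← Polynomial.eval_map, ← Polynomial.eval_map]
  rcases le_total x y with hxy | hxy
  · refine pos_iff_pos_of_mul_pos (hR.eval_mul_eval_pos hxy fun c hc hc' => ?_)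
    rw [Polynomial.eval_map]
    exact hn c (hx.trans_le hc) (hc'.trans_lt hy')
  · refine (pos_iff_pos_of_mul_pos (hR.eval_mul_eval_pos hxy fun c hc hc' => ?_)).symm
    rw [Polynomial.eval_map]
    exact hn c (hy.trans_le hc) (hc'.trans_lt hx')

namespace SignCompat

variable {G R₁ R₂ : Type*} [CommRing G] [Field R₁] [LinearOrder R₁] [IsStrictOrderedRing R₁]
  [Field R₂] [LinearOrder R₂] [IsStrictOrderedRing R₂] {i₁ : G →+* R₁} {i₂ : G →+* R₂}

theorem exists_root_forall_mem_finset (h : SignCompat i₁ i₂) (hR₁ : PolyIVT R₁)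
    (hR₂ : PolyIVT R₂) (hhalf : ∃ e : G, e * 2 = 1) {p : Polynomial G} (hp : p.Monic)
    (h₁ : ∀ q : Polynomial G, q.map i₁ ≠ 0 → q.natDegree < p.natDegree →
      ∀ s, q.eval₂ i₁ s = 0 → ∃ g, i₁ g = s)
    (h₂ : ∀ q : Polynomial G, q.map i₂ ≠ 0 → q.natDegree < p.natDegree →
      ∀ s, q.eval₂ i₂ s = 0 → ∃ g, i₂ g = s)
    {t : R₁} (ht : p.eval₂ i₁ t = 0) (htG : ∀ g, i₁ g ≠ t) (Q : Finset (Polynomial G))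
    (hQ : ∀ q ∈ Q, q.map i₁ ≠ 0 ∧ q.natDegree < p.natDegree) :
    ∃ t' : R₂, p.eval₂ i₂ t' = 0 ∧ ∀ q ∈ Q, (0 < q.eval₂ i₁ t ↔ 0 < q.eval₂ i₂ t') := by
  classical
  have hd : p.natDegree ≠ 0 := by
    intro h0
    rw [hp.natDegree_eq_zero.1 h0] at ht
    simp at ht
  have hder : p.derivative.map i₁ ≠ 0 := by
    rw [← Polynomial.derivative_map]
    intro h0
    have := Polynomial.derivative_eq_zero.1 h0
    rw [hp.natDegree_map] at this
    exact hd this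
  set S : Finset (Polynomial G) := insert p.derivative Q with hS
  have hSprop : ∀ q ∈ S, q.map i₁ ≠ 0 ∧ q.natDegree < p.natDegree := by
    intro q hq
    rcases Finset.mem_insert.1 hq with rfl | hq
    · exact ⟨hder, Polynomial.natDegree_derivative_lt hd⟩
    · exact hQ q hq
  set W : Finset R₁ := S.biUnion fun q => (q.map i₁).roots.toFinset with hW
  have hWmem : ∀ c, c ∈ W ↔ ∃ q ∈ S, q.eval₂ i₁ c = 0 := by
    intro c
    simp only [hW, Finset.mem_biUnion, Multiset.mem_toFinset]
    refine exists_congr fun q => and_congr_right fun hq => ?_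
    rw [Polynomial.mem_roots (hSprop q hq).1, Polynomial.IsRoot.def, Polynomial.eval_map]
  have hWG : ∀ c ∈ W, ∃ g, i₁ g = c := by
    intro c hc
    obtain ⟨q, hq, h0⟩ := (hWmem c).1 hc
    exact h₁ q (hSprop q hq).1 (hSprop q hq).2 c h0
  set M := 1 + ∑ k ∈ Finset.range p.natDegree, (1 + p.coeff k ^ 2)
  have hM : |t| < i₁ M := Polynomial.abs_lt_of_monic_of_eval₂_eq_zero i₁ hp hd ht
  obtain ⟨hM1, hM2⟩ := abs_lt.1 hM
  -- the neighbours of `t` among the images of the special points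
  obtain ⟨w, hw, hwmax⟩ := ((insert (-i₁ M) W).filter (· < t)).exists_max_image id
    ⟨-i₁ M, by simp [hM1]⟩
  obtain ⟨w', hw', hwmin⟩ := ((insert (i₁ M) W).filter (t < ·)).exists_min_image id
    ⟨i₁ M, by simp [hM2]⟩
  simp only [Finset.mem_filter, Finset.mem_insert, id] at hw hwmax hw' hwmin
  obtain ⟨a, ha⟩ : ∃ a, i₁ a = w := by
    rcases hw.1 with h0 | h0
    · exact ⟨-M, by simp [h0]⟩
    · exact hWG _ h0
  obtain ⟨b, hb⟩ : ∃ b, i₁ b = w' := by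
    rcases hw'.1 with h0 | h0
    · exact ⟨M, by simp [h0]⟩
    · exact hWG _ h0
  subst ha hb
  have hat := hw.2
  have htb := hw'.2
  have hno : ∀ q ∈ S, ∀ c, i₁ a < c → c < i₁ b → q.eval₂ i₁ c ≠ 0 := by
    intro q hq c hac hcb h0
    have hc := (hWmem c).2 ⟨q, hq, h0⟩
    rcases lt_trichotomy c t with hlt | rfl | hlt
    · exact absurd hac (hwmax c ⟨.inr hc, hlt⟩).not_gt
    · obtain ⟨g, hg⟩ := hWG _ hc
      exact htG g hg
    · exact absurd hcb (hwmin c ⟨.inr hc, hlt⟩).not_gt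
  have hno₂ : ∀ q ∈ S, ∀ c, i₂ a < c → c < i₂ b → q.eval₂ i₂ c ≠ 0 := by
    intro q hq c hac hcb h0
    obtain ⟨g, rfl⟩ := h₂ q (fun h' => (hSprop q hq).1 ((h.map_eq_zero_iff q).2 h'))
      (hSprop q hq).2 c h0
    rw [Polynomial.eval₂_at_apply] at h0
    refine hno q hq (i₁ g) ((h.lt_iff _ _).2 hac) ((h.lt_iff _ _).2 hcb) ?_
    rw [Polynomial.eval₂_at_apply]
    exact (h.eq_zero_iff _).2 h0
  have hneg : (p.map i₁).eval (i₁ a) * (p.map i₁).eval (i₁ b) < 0 := by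
    refine hR₁.eval_mul_eval_neg_of_root hat htb (by rwa [Polynomial.eval_map]) fun c hc hc' => ?_
    rw [Polynomial.derivative_map, Polynomial.eval_map]
    exact hno _ (Finset.mem_insert_self _ _) c hc hc'
  have hneg₂ : (p.map i₂).eval (i₂ a) * (p.map i₂).eval (i₂ b) < 0 := by
    simp only [Polynomial.eval_map, Polynomial.eval₂_at_apply, ← map_mul] at hneg ⊢
    exact (h.neg_iff _).1 hneg
  obtain ⟨t', hat', htb', ht'⟩ := hR₂ _ _ _ ((h.lt_iff _ _).1 (hat.trans htb)) hneg₂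
  refine ⟨t', by rwa [Polynomial.eval_map] at ht', fun q hq => ?_⟩
  have hqS : q ∈ S := Finset.mem_insert_of_mem hq
  obtain ⟨e, he⟩ := hhalf
  have hmid₁ := lt_map_midpoint i₁ he (hat.trans htb)
  have hmid₂ := lt_map_midpoint i₂ he ((h.lt_iff _ _).1 (hat.trans htb))
  rw [hR₁.eval₂_pos_iff i₁ (hno q hqS) t _ hat htb hmid₁.1 hmid₁.2,
    hR₂.eval₂_pos_iff i₂ (hno₂ q hqS) t' _ hat' htb' hmid₂.1 hmid₂.2,
    Polynomial.eval₂_at_apply, Polynomial.eval₂_at_apply]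
  exact h _

theorem exists_root (h : SignCompat i₁ i₂) (hR₁ : PolyIVT R₁)
    (hR₂ : PolyIVT R₂) (hhalf : ∃ e : G, e * 2 = 1) {p : Polynomial G} (hp : p.Monic)
    (h₁ : ∀ q : Polynomial G, q.map i₁ ≠ 0 → q.natDegree < p.natDegree →
      ∀ s, q.eval₂ i₁ s = 0 → ∃ g, i₁ g = s)
    (h₂ : ∀ q : Polynomial G, q.map i₂ ≠ 0 → q.natDegree < p.natDegree →
      ∀ s, q.eval₂ i₂ s = 0 → ∃ g, i₂ g = s)
    {t : R₁} (ht : p.eval₂ i₁ t = 0) (htG : ∀ g, i₁ g ≠ t) :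
    ∃ t' : R₂, ∀ q : Polynomial G, (0 < q.eval₂ i₁ t ↔ 0 < q.eval₂ i₂ t') := by
  classical
  by_contra! hbad
  have hp1 : p ≠ 1 := by rintro rfl; simp at ht
  have hbad' : ∀ t' : R₂, ∃ r : Polynomial G, p.eval₂ i₂ t' = 0 →
      r.map i₁ ≠ 0 ∧ r.natDegree < p.natDegree ∧
        ¬ (0 < r.eval₂ i₁ t ↔ 0 < r.eval₂ i₂ t') := by
    intro t'
    obtain ⟨q, hq⟩ := hbad t'
    refine ⟨q %ₘ p, fun ht' => ?_⟩
    have hq' : ¬ (0 < (q %ₘ p).eval₂ i₁ t ↔ 0 < (q %ₘ p).eval₂ i₂ t') := by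
      rw [Polynomial.eval₂_modByMonic_eq_self_of_root ht,
        Polynomial.eval₂_modByMonic_eq_self_of_root ht', iff_iff_and_or_not_and_not]
      push Not
      rcases hq with hq | hq
      · exact ⟨fun _ => hq.2, fun h' => absurd hq.1 h'.not_gt⟩
      · exact ⟨fun h' => absurd h' hq.1.not_gt, fun _ => hq.2⟩
    refine ⟨fun h0 => hq' ?_, Polynomial.natDegree_modByMonic_lt q hp hp1, hq'⟩
    rw [← Polynomial.eval_map, ← Polynomial.eval_map, h0, (h.map_eq_zero_iff _).1 h0]
    simp
  choose r hr using hbad'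
  have hpm : p.map i₂ ≠ 0 := (hp.map i₂).ne_zero
  have hmem : ∀ t', t' ∈ (p.map i₂).roots.toFinset ↔ p.eval₂ i₂ t' = 0 := by
    intro t'
    rw [Multiset.mem_toFinset, Polynomial.mem_roots hpm, Polynomial.IsRoot.def,
      Polynomial.eval_map]
  obtain ⟨t', ht', hQ⟩ := h.exists_root_forall_mem_finset hR₁ hR₂ hhalf hp h₁ h₂ ht htG
    ((p.map i₂).roots.toFinset.image r) (by
      intro q hq
      obtain ⟨s, hs, rfl⟩ := Finset.mem_image.1 hq
      exact ⟨(hr s ((hmem s).1 hs)).1, (hr s ((hmem s).1 hs)).2.1⟩)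
  exact (hr t' ht').2.2 (hQ _ (Finset.mem_image_of_mem _ ((hmem t').2 ht')))

end SignCompat

theorem eval₂_inv_mul_pow {G R : Type*} [CommRing G] [Field R] (i : G →+* R) {a : G}
    (ha : i a ≠ 0) (q : Polynomial G) :
    q.eval₂ i (i a)⁻¹ * i a ^ (2 * q.natDegree)
      = i (∑ k ∈ Finset.range (q.natDegree + 1), q.coeff k * a ^ (2 * q.natDegree - k)) := by
  rw [Polynomial.eval₂_eq_sum_range, Finset.sum_mul, map_sum]
  refine Finset.sum_congr rfl fun k hk => ?_
  have hk : k ≤ 2 * q.natDegree := by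
    have := Finset.mem_range.1 hk
    omega
  rw [map_mul, map_pow, pow_sub₀ _ ha hk, inv_pow]
  ring

section SignSubring

variable {R₁ R₂ : Type*} [Field R₁] [LinearOrder R₁] [IsStrictOrderedRing R₁]
  [Field R₂] [LinearOrder R₂] [IsStrictOrderedRing R₂]

/-- The subrings of a product of two ordered fields whose elements have components of the same
sign. -/
def signSubrings (R₁ R₂ : Type*) [Field R₁] [LinearOrder R₁] [Field R₂] [LinearOrder R₂] :
    Set (Subring (R₁ × R₂)) :=
  {G | ∀ x ∈ G, 0 < x.1 ↔ 0 < x.2}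

omit [IsStrictOrderedRing R₁] [IsStrictOrderedRing R₂] in
theorem exists_maximal_signSubrings {G₀ : Subring (R₁ × R₂)} (h₀ : G₀ ∈ signSubrings R₁ R₂) :
    ∃ G, G₀ ≤ G ∧ Maximal (· ∈ signSubrings R₁ R₂) G := by
  refine zorn_le_nonempty₀ _ (fun c hc hchain y hy => ?_) G₀ h₀
  refine ⟨sSup c, fun x hx => ?_, fun z hz => le_sSup hz⟩
  rw [Subring.mem_sSup_of_directedOn ⟨y, hy⟩ hchain.directedOn] at hx
  obtain ⟨s, hs, hx⟩ := hx
  exact hc hs x hx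

variable {G : Subring (R₁ × R₂)} (hG : Maximal (· ∈ signSubrings R₁ R₂) G)

/-- The first projection of a subring of a product. -/
abbrev Subring.fstHom {R₁ R₂ : Type*} [Ring R₁] [Ring R₂] (G : Subring (R₁ × R₂)) : G →+* R₁ :=
  (RingHom.fst R₁ R₂).comp G.subtype

/-- The second projection of a subring of a product. -/
abbrev Subring.sndHom {R₁ R₂ : Type*} [Ring R₁] [Ring R₂] (G : Subring (R₁ × R₂)) : G →+* R₂ :=
  (RingHom.snd R₁ R₂).comp G.subtype

namespace signSubrings

omit [IsStrictOrderedRing R₁] [IsStrictOrderedRing R₂] in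
theorem signCompat (hG : G ∈ signSubrings R₁ R₂) : SignCompat G.fstHom G.sndHom :=
  fun g => hG g.1 g.2

theorem eq_zero (hG : G ∈ signSubrings R₁ R₂) {a : G} (ha : G.fstHom a = 0) : a = 0 :=
  Subtype.ext (Prod.ext ha (((signCompat hG).eq_zero_iff a).1 ha))

theorem fst_injective (hG : G ∈ signSubrings R₁ R₂) : Function.Injective G.fstHom :=
  (injective_iff_map_eq_zero _).2 fun _ => eq_zero hG

include hG

omit [IsStrictOrderedRing R₁] [IsStrictOrderedRing R₂] in
theorem mem_of_maximal (x : R₁ × R₂)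
    (hx : ∀ q : Polynomial G, 0 < q.eval₂ G.fstHom x.1 ↔ 0 < q.eval₂ G.sndHom x.2) : x ∈ G := by
  have hle : G ≤ (Polynomial.eval₂RingHom G.subtype x).range := fun y hy =>
    ⟨Polynomial.C ⟨y, hy⟩, by simp⟩
  refine hG.le_of_ge (y := (Polynomial.eval₂RingHom G.subtype x).range) ?_ hle
    ⟨Polynomial.X, by simp⟩
  rintro _ ⟨q, rfl⟩
  have h1 := Polynomial.hom_eval₂ q G.subtype (RingHom.fst R₁ R₂) x
  have h2 := Polynomial.hom_eval₂ q G.subtype (RingHom.snd R₁ R₂) x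
  simp only [RingHom.coe_fst, RingHom.coe_snd] at h1 h2
  rw [Polynomial.coe_eval₂RingHom, h1, h2]
  exact hx q

theorem exists_mul_eq_one {a : G} (ha : a ≠ 0) : ∃ b : G, b * a = 1 := by
  have h1 : G.fstHom a ≠ 0 := fun h => ha (eq_zero hG.prop h)
  have h2 : G.sndHom a ≠ 0 := fun h => h1 (((signCompat hG.prop).eq_zero_iff a).2 h)
  suffices ((G.fstHom a)⁻¹, (G.sndHom a)⁻¹) ∈ G from
    ⟨⟨_, this⟩, Subtype.ext (Prod.ext (inv_mul_cancel₀ h1) (inv_mul_cancel₀ h2))⟩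
  refine mem_of_maximal hG _ fun q => ?_
  have e1 := eval₂_inv_mul_pow G.fstHom h1 q
  have e2 := eval₂_inv_mul_pow G.sndHom h2 q
  have p1 : 0 < G.fstHom a ^ (2 * q.natDegree) := (even_two_mul _).pow_pos h1
  have p2 : 0 < G.sndHom a ^ (2 * q.natDegree) := (even_two_mul _).pow_pos h2
  rw [← mul_pos_iff_of_pos_right p1, ← mul_pos_iff_of_pos_right p2, e1, e2]
  exact signCompat hG.prop _

theorem exists_mul_two_eq_one : ∃ e : G, e * 2 = 1 := by
  refine exists_mul_eq_one hG fun h => ?_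
  have := congrArg G.fstHom h
  rw [map_ofNat, map_zero] at this
  exact two_ne_zero this

theorem exists_eq_of_eval₂_eq_zero (hR₁ : PolyIVT R₁) (hR₂ : PolyIVT R₂) (q : Polynomial G)
    (hq : q ≠ 0) : (∀ s, q.eval₂ G.fstHom s = 0 → ∃ g, G.fstHom g = s) ∧
      ∀ s, q.eval₂ G.sndHom s = 0 → ∃ g, G.sndHom g = s := by
  induction hn : q.natDegree using Nat.strong_induction_on generalizing q with
  | _ n ih =>
  obtain ⟨b, hb⟩ := exists_mul_eq_one hG (Polynomial.leadingCoeff_ne_zero.2 hq)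
  have hp : (Polynomial.C b * q).Monic := Polynomial.monic_C_mul_of_mul_leadingCoeff_eq_one hb
  have hpd : (Polynomial.C b * q).natDegree = n := by
    rw [← hn]
    exact Polynomial.natDegree_C_mul_eq_of_mul_eq_one (by rwa [mul_comm] at hb)
  have hhalf : ∃ e : G, e * 2 = 1 := exists_mul_two_eq_one hG
  have hS := signCompat hG.prop
  have h1 : ∀ r : Polynomial G, r.map G.fstHom ≠ 0 →
      r.natDegree < (Polynomial.C b * q).natDegree →
      ∀ s, r.eval₂ G.fstHom s = 0 → ∃ g, G.fstHom g = s := by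
    intro r hr hrd
    refine (ih _ (hpd ▸ hrd) r ?_ rfl).1
    rintro rfl
    simp at hr
  have h2 : ∀ r : Polynomial G, r.map G.sndHom ≠ 0 →
      r.natDegree < (Polynomial.C b * q).natDegree →
      ∀ s, r.eval₂ G.sndHom s = 0 → ∃ g, G.sndHom g = s := by
    intro r hr hrd
    refine (ih _ (hpd ▸ hrd) r ?_ rfl).2
    rintro rfl
    simp at hr
  constructor
  · intro s hs
    by_contra! hcon
    obtain ⟨t, ht⟩ := hS.exists_root hR₁ hR₂ hhalf hp h1 h2
      (by rw [Polynomial.eval₂_mul, hs, mul_zero]) hcon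
    exact hcon ⟨_, mem_of_maximal hG (s, t) ht⟩ rfl
  · intro s hs
    by_contra! hcon
    obtain ⟨t, ht⟩ := hS.symm.exists_root hR₂ hR₁ hhalf hp h2 h1
      (by rw [Polynomial.eval₂_mul, hs, mul_zero]) hcon
    exact hcon ⟨_, mem_of_maximal hG (t, s) fun q => (ht q).symm⟩ rfl

theorem exists_forall_mem_finset (hR₁ : PolyIVT R₁) (hR₂ : PolyIVT R₂) (t : R₁)
    (S : Finset (Polynomial G)) :
    ∃ t' : R₂, ∀ p ∈ S, (0 < p.eval₂ G.fstHom t ↔ 0 < p.eval₂ G.sndHom t') := by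
  classical
  have hS := signCompat hG.prop
  suffices ∃ m : G, ∀ p ∈ S, (0 < p.eval₂ G.fstHom t ↔ 0 < p.eval₂ G.fstHom (G.fstHom m)) by
    obtain ⟨m, hm⟩ := this
    refine ⟨G.sndHom m, fun p hp => ?_⟩
    rw [hm p hp, Polynomial.eval₂_at_apply, Polynomial.eval₂_at_apply]
    exact hS _
  by_cases htG : ∃ m, G.fstHom m = t
  · obtain ⟨m, rfl⟩ := htG
    exact ⟨m, fun _ _ => Iff.rfl⟩
  set W : Finset R₁ := S.biUnion fun q => (q.map G.fstHom).roots.toFinset with hW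
  have hWmem : ∀ c, c ∈ W ↔ ∃ q ∈ S, q ≠ 0 ∧ q.eval₂ G.fstHom c = 0 := by
    intro c
    simp only [hW, Finset.mem_biUnion, Multiset.mem_toFinset]
    refine exists_congr fun q => and_congr_right fun hq => ?_
    rw [Polynomial.mem_roots', Polynomial.IsRoot.def, Polynomial.eval_map,
      Polynomial.map_ne_zero_iff (fst_injective hG.prop)]
  have hWG : ∀ c ∈ W, ∃ g, G.fstHom g = c := by
    intro c hc
    obtain ⟨q, _, hq, h0⟩ := (hWmem c).1 hc
    exact (exists_eq_of_eval₂_eq_zero hG hR₁ hR₂ q hq).1 c h0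
  suffices ∃ m : G, (∀ c ∈ W, c < t → c < G.fstHom m) ∧ ∀ c ∈ W, t < c → G.fstHom m < c by
    obtain ⟨m, hm1, hm2⟩ := this
    refine ⟨m, fun p hp => ?_⟩
    by_cases hp0 : p = 0
    · simp [hp0]
    have hne : ∀ c, p.eval₂ G.fstHom c = 0 → (c < t ∧ c < G.fstHom m) ∨
        (t < c ∧ G.fstHom m < c) := by
      intro c hc
      have hc := (hWmem c).2 ⟨p, hp, hp0, hc⟩
      rcases lt_trichotomy c t with h | h | h
      · exact .inl ⟨h, hm1 c hc h⟩
      · exact absurd (h ▸ hWG c hc) htG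
      · exact .inr ⟨h, hm2 c hc h⟩
    rw [← Polynomial.eval_map, ← Polynomial.eval_map]
    rcases le_total t (G.fstHom m) with hxy | hxy
    · refine pos_iff_pos_of_mul_pos (hR₁.eval_mul_eval_pos hxy fun c hc hc' h0 => ?_)
      rw [Polynomial.eval_map] at h0
      rcases hne c h0 with h | h
      · exact hc.not_gt h.1
      · exact hc'.not_gt h.2
    · refine (pos_iff_pos_of_mul_pos (hR₁.eval_mul_eval_pos hxy fun c hc hc' h0 => ?_)).symm
      rw [Polynomial.eval_map] at h0
      rcases hne c h0 with h | h
      · exact hc.not_gt h.2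
      · exact hc'.not_gt h.1
  rcases (W.filter (· < t)).eq_empty_or_nonempty with hL | hL <;>
    rcases (W.filter (t < ·)).eq_empty_or_nonempty with hU | hU
  · refine ⟨0, fun c hc hct => ?_, fun c hc hct => ?_⟩
    · exact absurd (Finset.mem_filter.2 ⟨hc, hct⟩) (hL ▸ Finset.notMem_empty c)
    · exact absurd (Finset.mem_filter.2 ⟨hc, hct⟩) (hU ▸ Finset.notMem_empty c)
  · obtain ⟨b, hb, hbmin⟩ := Finset.exists_min_image _ id hU
    simp only [Finset.mem_filter, id] at hb hbmin
    obtain ⟨b, rfl⟩ := hWG b hb.1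
    refine ⟨b - 1, fun c hc hct => ?_, fun c hc hct => ?_⟩
    · exact absurd (Finset.mem_filter.2 ⟨hc, hct⟩) (hL ▸ Finset.notMem_empty c)
    · have := hbmin c ⟨hc, hct⟩
      rw [map_sub, map_one]
      linarith
  · obtain ⟨a, ha, hamax⟩ := Finset.exists_max_image _ id hL
    simp only [Finset.mem_filter, id] at ha hamax
    obtain ⟨a, rfl⟩ := hWG a ha.1
    refine ⟨a + 1, fun c hc hct => ?_, fun c hc hct => ?_⟩
    · have := hamax c ⟨hc, hct⟩
      rw [map_add, map_one]
      linarith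
    · exact absurd (Finset.mem_filter.2 ⟨hc, hct⟩) (hU ▸ Finset.notMem_empty c)
  · obtain ⟨a, ha, hamax⟩ := Finset.exists_max_image _ id hL
    obtain ⟨b, hb, hbmin⟩ := Finset.exists_min_image _ id hU
    simp only [Finset.mem_filter, id] at ha hamax hb hbmin
    obtain ⟨a, rfl⟩ := hWG a ha.1
    obtain ⟨b, rfl⟩ := hWG b hb.1
    obtain ⟨e, he⟩ := exists_mul_two_eq_one hG
    obtain ⟨h1, h2⟩ := lt_map_midpoint G.fstHom he (ha.2.trans hb.2)
    exact ⟨(a + b) * e, fun c hc hct => (hamax c ⟨hc, hct⟩).trans_lt h1,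
      fun c hc hct => h2.trans_le (hbmin c ⟨hc, hct⟩)⟩

end signSubrings

end SignSubring

theorem SignCompat.exists_forall_mem_finset {C R₁ R₂ : Type*} [CommRing C] [Field R₁]
    [LinearOrder R₁] [IsStrictOrderedRing R₁] [Field R₂] [LinearOrder R₂] [IsStrictOrderedRing R₂]
    {φ₁ : C →+* R₁} {φ₂ : C →+* R₂} (h : SignCompat φ₁ φ₂) (hR₁ : PolyIVT R₁)
    (hR₂ : PolyIVT R₂) (t : R₁) (S : Finset (Polynomial C)) :
    ∃ t' : R₂, ∀ p ∈ S, (0 < p.eval₂ φ₁ t ↔ 0 < p.eval₂ φ₂ t') := by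
  classical
  obtain ⟨G, hle, hG⟩ := exists_maximal_signSubrings (G₀ := (φ₁.prod φ₂).range) (by
    rintro _ ⟨c, rfl⟩
    exact h c)
  let j : C →+* G := (φ₁.prod φ₂).codRestrict G fun c => hle ⟨c, rfl⟩
  obtain ⟨t', ht'⟩ := signSubrings.exists_forall_mem_finset hG hR₁ hR₂ t
    (S.image (Polynomial.map j))
  refine ⟨t', fun p hp => ?_⟩
  have := ht' _ (Finset.mem_image_of_mem _ hp)
  rw [Polynomial.eval₂_map, Polynomial.eval₂_map] at this
  exact this

theorem RingHom.map_pos_iff_of_real {R : Type*} [Field R] [LinearOrder R] [IsStrictOrderedRing R]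
    (φ : ℝ →+* R) (r : ℝ) : 0 < φ r ↔ 0 < r := by
  have h : ∀ s : ℝ, 0 < s → 0 < φ s := fun s hs => by
    rw [← Real.sq_sqrt hs.le, map_pow]
    exact sq_pos_of_ne_zero (by simpa using (Real.sqrt_pos.2 hs).ne')
  refine ⟨fun hr => ?_, h r⟩
  rcases lt_trichotomy r 0 with h0 | rfl | h0
  · have := h (-r) (by linarith)
    rw [map_neg] at this
    linarith
  · simp at hr
  · exact h0

theorem exists_eval_pos_iff_fin {R : Type*} [Field R] [LinearOrder R] [IsStrictOrderedRing R]
    (hR : PolyIVT R) (n : ℕ) (φ : MvPolynomial (Fin n) ℝ →+* R)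
    (S : Finset (MvPolynomial (Fin n) ℝ)) :
    ∃ b : Fin n → ℝ, ∀ p ∈ S, (0 < φ p ↔ 0 < eval b p) := by
  classical
  induction n with
  | zero =>
    refine ⟨Fin.elim0, fun p _ => ?_⟩
    rw [eq_C_of_isEmpty p, eval_C]
    exact (φ.comp C).map_pos_iff_of_real _
  | succ n ih =>
    let e := finSuccEquiv ℝ n
    let ψ : Polynomial (MvPolynomial (Fin n) ℝ) →+* R := φ.comp (e.symm : _ →+* _)
    have hψ : ∀ q, ψ q = q.eval₂ (ψ.comp Polynomial.C) (ψ Polynomial.X) := fun q => by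
      rw [← Polynomial.hom_eval₂, Polynomial.eval₂_C_X]
    have hφ : ∀ p, φ p = ψ (e p) := fun p => by simp [ψ]
    choose b hb using fun E => ih (ψ.comp Polynomial.C) E
    let U : Ultrafilter (Finset (MvPolynomial (Fin n) ℝ)) := Ultrafilter.of Filter.atTop
    have hU : (U : Filter (Finset (MvPolynomial (Fin n) ℝ))) ≤ Filter.atTop :=
      Ultrafilter.of_le Filter.atTop
    let Γ : MvPolynomial (Fin n) ℝ →+* (Finset (MvPolynomial (Fin n) ℝ) → ℝ) :=
      RingHom.pi fun E => eval (b E)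
    let Φ : (Finset (MvPolynomial (Fin n) ℝ) → ℝ) →+* Filter.Germ (U : Filter _) ℝ :=
      Filter.Germ.coeRingHom _
    have hΦ : ∀ u, 0 < Φ u ↔ ∀ᶠ E in (U : Filter _), 0 < u E := fun u =>
      Filter.Germ.coe_pos
    have hcompat : SignCompat (ψ.comp Polynomial.C) (Φ.comp Γ) := by
      intro p
      have hev : ∀ᶠ E in (U : Filter _), (0 < ψ (Polynomial.C p) ↔ 0 < eval (b E) p) :=
        hU ((Filter.eventually_ge_atTop {p}).mono fun E hE => hb E p (hE (by simp)))
      refine Iff.trans ?_ (hΦ _).symm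
      exact ⟨fun h => hev.mono fun E hE => hE.1 h,
        fun h => let ⟨E, hE, hE'⟩ := (hev.and h).exists; hE.2 hE'⟩
    obtain ⟨t', ht'⟩ := hcompat.exists_forall_mem_finset hR (polyIVT_germ U)
      (ψ Polynomial.X) (S.image e)
    obtain ⟨τ, rfl⟩ := Quotient.exists_rep t'
    have hev : ∀ p ∈ S, ∀ᶠ E in (U : Filter _),
        (0 < φ p ↔ 0 < eval (Fin.cons (τ E) (b E)) p) := by
      intro p hp
      have h1 := ht' _ (Finset.mem_image_of_mem _ hp)
      have h2 : (e p).eval₂ (Φ.comp Γ) (Φ τ) = Φ ((e p).eval₂ Γ τ) :=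
        (Polynomial.hom_eval₂ _ _ _ _).symm
      have h3 : ∀ E, ((e p).eval₂ Γ τ) E = eval (Fin.cons (τ E) (b E)) p := fun E => by
        rw [eval_eq_eval_mv_eval', Polynomial.eval_map]
        exact Polynomial.hom_eval₂ (e p) Γ (Pi.evalRingHom _ E) τ
      have h4 : 0 < φ p ↔ ∀ᶠ E in (U : Filter _), 0 < eval (Fin.cons (τ E) (b E)) p := by
        rw [hφ, hψ, h1]
        refine (iff_of_eq (congrArg _ h2)).trans ((hΦ _).trans ?_)
        simp only [h3]
      by_cases h : 0 < φ p
      · simpa only [h, true_iff] using h4.1 h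
      · simpa only [h, false_iff] using Ultrafilter.eventually_not.2 (fun h' => h (h4.2 h'))
    obtain ⟨E, hE⟩ := ((Filter.eventually_all_finset S).2 hev).exists
    exact ⟨_, hE⟩

theorem exists_eval_pos_iff {R σ : Type*} [Field R] [LinearOrder R] [IsStrictOrderedRing R]
    [Fintype σ] (hR : PolyIVT R) (φ : MvPolynomial σ ℝ →+* R) (S : Finset (MvPolynomial σ ℝ)) :
    ∃ b : σ → ℝ, ∀ p ∈ S, (0 < φ p ↔ 0 < eval b p) := by
  classical
  let ε := Fintype.equivFin σ
  obtain ⟨b, hb⟩ := exists_eval_pos_iff_fin hR _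
    (φ.comp ((rename ε.symm : _ →ₐ[ℝ] MvPolynomial σ ℝ) : _ →+* _)) (S.image (rename ε))
  refine ⟨b ∘ ε, fun p hp => ?_⟩
  have := hb _ (Finset.mem_image_of_mem _ hp)
  simpa [rename_rename, eval_rename] using this

/-- Weak-inequality form of transfer. -/
theorem exists_eval_nonneg {R σ : Type*} [Field R] [LinearOrder R] [IsStrictOrderedRing R]
    [Fintype σ] (hR : PolyIVT R) (φ : MvPolynomial σ ℝ →+* R) (S : Finset (MvPolynomial σ ℝ))
    (hS : ∀ p ∈ S, 0 ≤ φ p) : ∃ b : σ → ℝ, ∀ p ∈ S, 0 ≤ eval b p := by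
  classical
  obtain ⟨b, hb⟩ := exists_eval_pos_iff hR φ (S.image Neg.neg)
  refine ⟨b, fun p hp => ?_⟩
  have := (hb _ (Finset.mem_image_of_mem _ hp)).not
  simp only [map_neg, Left.neg_pos_iff, not_lt] at this
  exact this.1 (hS p hp)

namespace RingPreordering

variable {A : Type*} [CommRing A]

/-- The preordering obtained by adjoining an element. -/
def adjoin (P : RingPreordering A) (a : A) (h : ∀ p ∈ P, ∀ q ∈ P, -1 ≠ p + a * q) :
    RingPreordering A :=
  RingPreordering.mk' {x | ∃ p ∈ P, ∃ q ∈ P, x = p + a * q}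
    (by
      rintro _ _ ⟨p, hp, q, hq, rfl⟩ ⟨r, hr, s, hs, rfl⟩
      exact ⟨p + r, add_mem hp hr, q + s, add_mem hq hs, by ring⟩)
    (by
      rintro _ _ ⟨p, hp, q, hq, rfl⟩ ⟨r, hr, s, hs, rfl⟩
      exact ⟨p * r + a ^ 2 * (q * s), add_mem (mul_mem hp hr)
        (mul_mem (P.pow_two_mem a) (mul_mem hq hs)), p * s + q * r,
        add_mem (mul_mem hp hs) (mul_mem hq hr), by ring⟩)
    (fun x => ⟨x * x, P.mul_self_mem x, 0, zero_mem P, by ring⟩)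
    (fun ⟨p, hp, q, hq, e⟩ => h p hp q hq e)

theorem exists_neg_one_eq_of_isMax {P : RingPreordering A} (hP : IsMax P) {a : A} (ha : a ∉ P) :
    ∃ p ∈ P, ∃ q ∈ P, -1 = p + a * q := by
  by_contra! h
  refine ha (hP (b := P.adjoin a h) (fun p hp => ⟨p, hp, 0, zero_mem P, by ring⟩) ?_)
  exact ⟨0, zero_mem P, 1, one_mem P, by ring⟩

theorem exists_le_isOrdering (P : RingPreordering A) : ∃ O, P ≤ O ∧ O.IsOrdering := by
  obtain ⟨O, hPO, hO⟩ := zorn_le_nonempty_Ici₀ P (fun c hc hchain y hy => by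
    have hmem : ∀ x, x ∈ sSup (toSubsemiring '' c) ↔ ∃ s ∈ c, x ∈ s := by
      intro x
      have hdir : DirectedOn (· ≤ ·) (toSubsemiring '' c) := by
        rintro _ ⟨s, hs, rfl⟩ _ ⟨t, ht, rfl⟩
        rcases hchain.total hs ht with h | h
        · exact ⟨_, ⟨t, ht, rfl⟩, h, le_rfl⟩
        · exact ⟨_, ⟨s, hs, rfl⟩, le_rfl, h⟩
      rw [Subsemiring.mem_sSup_of_directedOn (Set.Nonempty.image _ ⟨y, hy⟩) hdir]
      simp
    refine ⟨⟨sSup (toSubsemiring '' c), fun {x} hx => (hmem x).2 ⟨y, hy, y.mem_of_isSquare hx⟩,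
      fun h => ?_⟩, fun z hz x hx => (hmem x).2 ⟨z, hz, hx⟩⟩
    obtain ⟨s, _, hs⟩ := (hmem _).1 h
    exact s.neg_one_notMem hs) P le_rfl
  refine ⟨O, hPO, isOrdering_iff.2 fun a b hab => ?_⟩
  by_contra! h
  obtain ⟨p, hp, q, hq, e⟩ := exists_neg_one_eq_of_isMax hO h.1
  obtain ⟨r, hr, s, hs, e'⟩ := exists_neg_one_eq_of_isMax hO h.2
  refine O.neg_one_notMem ?_
  have : (-1 : A) = p + r + p * r + -(a * b) * (q * s) := by
    linear_combination (1 + r) * e - a * q * e'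
  rw [this]
  exact add_mem (add_mem (add_mem hp hr) (mul_mem hp hr)) (mul_mem hab (mul_mem hq hs))

end RingPreordering

/-- The non-negative cone of an ordered subfield of the field `Ω`. -/
structure IsFieldCone {Ω : Type*} [Field Ω] (P : Subsemiring Ω) : Prop where
  neg_one_notMem : -1 ∉ P
  inv_mem : ∀ {x}, x ∈ P → x⁻¹ ∈ P
  sub_mem_or : ∀ {x y}, x ∈ P → y ∈ P → x - y ∈ P ∨ y - x ∈ P

namespace IsFieldCone

variable {Ω : Type*} [Field Ω]

theorem map_ordering {F : Type*} [Field F] (ψ : F →+* Ω) (O : RingPreordering F)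
    [O.IsOrdering] : IsFieldCone (O.toSubsemiring.map ψ) where
  neg_one_notMem := by
    rintro ⟨x, hx, h⟩
    have : x = -1 := ψ.injective (by rw [h, map_neg, map_one])
    exact O.neg_one_notMem (this ▸ hx)
  inv_mem := by
    rintro _ ⟨x, hx, rfl⟩
    exact ⟨x⁻¹, RingPreordering.inv_mem hx, map_inv₀ _ _⟩
  sub_mem_or := by
    rintro _ _ ⟨x, hx, rfl⟩ ⟨y, hy, rfl⟩
    rcases mem_or_neg_mem O (x - y) with h | h
    · exact .inl ⟨_, h, map_sub _ _ _⟩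
    · exact .inr ⟨y - x, by simpa using h, map_sub _ _ _⟩

theorem exists_maximal {P₀ : Subsemiring Ω} (h₀ : IsFieldCone P₀) :
    ∃ P, P₀ ≤ P ∧ Maximal IsFieldCone P := by
  refine zorn_le_nonempty₀ {P | IsFieldCone P} (fun c hc hchain y hy => ?_) P₀ h₀
  have hmem : ∀ x, x ∈ sSup c ↔ ∃ s ∈ c, x ∈ s := fun x =>
    Subsemiring.mem_sSup_of_directedOn ⟨y, hy⟩ hchain.directedOn
  refine ⟨sSup c, ⟨fun h => ?_, fun {x} hx => ?_, fun {x y} hx hy => ?_⟩,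
    fun z hz => le_sSup hz⟩
  · obtain ⟨s, hs, h⟩ := (hmem _).1 h
    exact (hc hs).neg_one_notMem h
  · obtain ⟨s, hs, h⟩ := (hmem _).1 hx
    exact (hmem _).2 ⟨s, hs, (hc hs).inv_mem h⟩
  · obtain ⟨s, hs, hx⟩ := (hmem _).1 hx
    obtain ⟨t, ht, hy⟩ := (hmem _).1 hy
    obtain ⟨u, hu, hxu, hyu⟩ : ∃ u ∈ c, x ∈ u ∧ y ∈ u := by
      rcases hchain.total hs ht with h | h
      · exact ⟨t, ht, h hx, hy⟩
      · exact ⟨s, hs, hx, h hy⟩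
    exact ((hc hu).sub_mem_or hxu hyu).imp (fun h => (hmem _).2 ⟨u, hu, h⟩)
      (fun h => (hmem _).2 ⟨u, hu, h⟩)

variable {P : Subsemiring Ω} (hP : IsFieldCone P)
include hP

theorem eq_zero {x : Ω} (h : x ∈ P) (h' : -x ∈ P) : x = 0 := by
  by_contra hx
  refine hP.neg_one_notMem ?_
  have := mul_mem h' (hP.inv_mem h)
  rwa [neg_mul, mul_inv_cancel₀ hx] at this

/-- The field whose non-negative cone is `P`. -/
def subfield : Subfield Ω where
  carrier := {x | x ∈ P ∨ -x ∈ P}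
  mul_mem' := by
    rintro x y (hx | hx) (hy | hy)
    · exact .inl (mul_mem hx hy)
    · exact .inr (by simpa using mul_mem hx hy)
    · exact .inr (by simpa using mul_mem hx hy)
    · exact .inl (by simpa using mul_mem hx hy)
  one_mem' := .inl (one_mem P)
  add_mem' := by
    rintro x y (hx | hx) (hy | hy)
    · exact .inl (add_mem hx hy)
    · simpa [add_comm, sub_eq_add_neg] using hP.sub_mem_or hx hy
    · simpa [add_comm, sub_eq_add_neg] using hP.sub_mem_or hy hx
    · exact .inr (by simpa [add_comm] using add_mem hx hy)
  zero_mem' := .inl (zero_mem P)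
  neg_mem' := by
    rintro x (hx | hx)
    · exact .inr (by simpa using hx)
    · exact .inl hx
  inv_mem' := by
    rintro x (hx | hx)
    · exact .inl (hP.inv_mem hx)
    · exact .inr (by simpa [inv_neg] using hP.inv_mem hx)

/-- The cone of non-negative elements, as a `RingCone`. -/
def ringCone : RingCone hP.subfield where
  __ := P.comap hP.subfield.subtype
  eq_zero_of_mem_of_neg_mem' := fun {_} h h' => Subtype.ext (hP.eq_zero h h')

theorem exists_linearOrder : ∃ (_ : LinearOrder hP.subfield) (_ : IsStrictOrderedRing hP.subfield),
    ∀ x : hP.subfield, 0 ≤ x ↔ (x : Ω) ∈ P := by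
  classical
  have : HasMemOrNegMem hP.ringCone := ⟨fun x => x.2⟩
  let _ : LinearOrder hP.subfield := LinearOrder.mkOfAddGroupCone hP.ringCone
  have : IsOrderedRing hP.subfield := IsOrderedRing.mkOfCone hP.ringCone
  refine ⟨inferInstance, inferInstance, fun x => ?_⟩
  have := PartialOrder.mkOfAddGroupCone_le_iff (C := hP.ringCone) (a := 0) (b := x)
  rw [sub_zero] at this
  exact this

end IsFieldCone

section WeightedSquares

variable (L : Type*) [Field L] [LinearOrder L] [IsStrictOrderedRing L]

/-- The subsemiring of sums of squares of polynomials with non-negative weights. -/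
def weightedSumSq : Subsemiring (Polynomial L) :=
  Submonoid.subsemiringClosure
    { carrier := {x | ∃ c : L, 0 ≤ c ∧ ∃ h, x = Polynomial.C c * h ^ 2}
      one_mem' := ⟨1, zero_le_one, 1, by simp⟩
      mul_mem' := by
        rintro _ _ ⟨c, hc, h, rfl⟩ ⟨d, hd, k, rfl⟩
        exact ⟨c * d, mul_nonneg hc hd, h * k, by rw [map_mul]; ring⟩ }

variable {L}

theorem C_mul_sq_mem_weightedSumSq {c : L} (hc : 0 ≤ c) (h : Polynomial L) :
    Polynomial.C c * h ^ 2 ∈ weightedSumSq L :=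
  AddSubmonoid.subset_closure ⟨c, hc, h, rfl⟩

theorem weightedSumSq_induction {motive : Polynomial L → Prop}
    (base : ∀ c : L, 0 ≤ c → ∀ h, motive (Polynomial.C c * h ^ 2))
    (hadd : ∀ s t, motive s → motive t → motive (s + t)) {s : Polynomial L}
    (hs : s ∈ weightedSumSq L) : motive s := by
  rw [weightedSumSq, Submonoid.subsemiringClosure_mem] at hs
  induction hs using AddSubmonoid.closure_induction with
  | mem x hx => rcases hx with ⟨c, hc, h, rfl⟩; exact base c hc h
  | zero => simpa using base 0 le_rfl 0
  | add s t _ _ hs ht => exact hadd s t hs ht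

theorem eval_nonneg_of_mem_weightedSumSq {s : Polynomial L} (hs : s ∈ weightedSumSq L) (a : L) :
    0 ≤ s.eval a := by
  refine weightedSumSq_induction (motive := fun s => 0 ≤ s.eval a) (fun c hc h => ?_)
    (fun s t h h' => ?_) hs
  · rw [Polynomial.eval_mul, Polynomial.eval_C, Polynomial.eval_pow]
    positivity
  · rw [Polynomial.eval_add]
    exact add_nonneg h h'

theorem exists_mem_weightedSumSq_natDegree_le {p : Polynomial L} (hp : p.natDegree ≠ 0)
    {s : Polynomial L} (hs : s ∈ weightedSumSq L) :
    ∃ t ∈ weightedSumSq L, p ∣ s - t ∧ t.natDegree + 2 ≤ 2 * p.natDegree := by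
  refine weightedSumSq_induction (motive := fun s => ∃ t ∈ weightedSumSq L, p ∣ s - t ∧
    t.natDegree + 2 ≤ 2 * p.natDegree) (fun c hc h => ?_) (fun s t h h' => ?_) hs
  · refine ⟨_, C_mul_sq_mem_weightedSumSq hc (h % p), ?_, ?_⟩
    · have : Polynomial.C c * h ^ 2 - Polynomial.C c * (h % p) ^ 2
          = (h - h % p) * (Polynomial.C c * (h + h % p)) := by ring
      rw [this]
      refine Dvd.dvd.mul_right ⟨h / p, ?_⟩ _
      rw [sub_eq_iff_eq_add, EuclideanDomain.div_add_mod]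
    · have h1 := Polynomial.natDegree_mod_lt h hp
      have h2 := (Polynomial.natDegree_C_mul_le c ((h % p) ^ 2)).trans Polynomial.natDegree_pow_le
      omega
  · obtain ⟨s', hs', h1, h2⟩ := h
    obtain ⟨t', ht', h3, h4⟩ := h'
    refine ⟨s' + t', add_mem hs' ht', ?_, ?_⟩
    · rw [add_sub_add_comm]
      exact dvd_add h1 h3
    · have := Polynomial.natDegree_add_le s' t'
      omega

omit [IsStrictOrderedRing L] in
theorem exists_irreducible_dvd_eval_mul_eval_neg [IsStrictOrderedRing L] {a b : L}
    {q : Polynomial L} (hq : q.eval a * q.eval b < 0) :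
    ∃ p, Irreducible p ∧ p ∣ q ∧ p.eval a * p.eval b < 0 := by
  induction q using WfDvdMonoid.induction_on_irreducible with
  | zero => simp at hq
  | unit u hu =>
    obtain ⟨c, _, rfl⟩ := Polynomial.isUnit_iff.1 hu
    rw [Polynomial.eval_C, Polynomial.eval_C] at hq
    exact absurd hq (mul_self_nonneg c).not_gt
  | mul r i _ hi ih =>
    by_cases h : i.eval a * i.eval b < 0
    · exact ⟨i, hi, dvd_mul_right _ _, h⟩
    · have : r.eval a * r.eval b < 0 := by
        rw [Polynomial.eval_mul, Polynomial.eval_mul] at hq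
        by_contra h'
        have := mul_nonneg (not_lt.1 h) (not_lt.1 h')
        have e : i.eval a * r.eval a * (i.eval b * r.eval b)
          = i.eval a * i.eval b * (r.eval a * r.eval b) := by ring
        rw [e] at hq
        exact hq.not_ge this
      obtain ⟨p, hp, hd, hp'⟩ := ih this
      exact ⟨p, hp, hd.mul_left _, hp'⟩

theorem not_dvd_one_add_of_eval_mul_eval_neg {a b : L} {p : Polynomial L} (hp : Irreducible p)
    (hab : p.eval a * p.eval b < 0) {s : Polynomial L} (hs : s ∈ weightedSumSq L) :
    ¬ p ∣ 1 + s := by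
  induction hn : p.natDegree using Nat.strong_induction_on generalizing p s with
  | _ n ih =>
  intro hdvd
  have hd : p.natDegree ≠ 0 := hp.natDegree_pos.ne'
  obtain ⟨t, ht, hst, htd⟩ := exists_mem_weightedSumSq_natDegree_le hd hs
  obtain ⟨k, hk⟩ : p ∣ 1 + t := by
    have : 1 + t = (1 + s) - (s - t) := by ring
    rw [this]
    exact dvd_sub hdvd hst
  have hpos : ∀ c, 0 < p.eval c * k.eval c := fun c => by
    rw [← Polynomial.eval_mul, ← hk, Polynomial.eval_add, Polynomial.eval_one]
    exact add_pos_of_pos_of_nonneg one_pos (eval_nonneg_of_mem_weightedSumSq ht c)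
  have hk0 : k ≠ 0 := by
    rintro rfl
    simpa using hpos a
  have hkd : k.natDegree < n := by
    have h1 := Polynomial.natDegree_mul hp.ne_zero hk0
    have h2 := Polynomial.natDegree_add_le 1 t
    rw [← hk] at h1
    rw [Polynomial.natDegree_one] at h2
    omega
  have hkab : k.eval a * k.eval b < 0 := by
    by_contra h
    have h1 := mul_pos (hpos a) (hpos b)
    have h2 := mul_nonpos_of_nonpos_of_nonneg hab.le (not_lt.1 h)
    have e : p.eval a * k.eval a * (p.eval b * k.eval b)
      = p.eval a * p.eval b * (k.eval a * k.eval b) := by ring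
    rw [e] at h1
    exact h1.not_ge h2
  obtain ⟨r, hr, hrk, hrab⟩ := exists_irreducible_dvd_eval_mul_eval_neg hkab
  exact ih _ ((Polynomial.natDegree_le_of_dvd hrk hk0).trans_lt hkd) hr hrab ht rfl
    (hrk.trans (hk ▸ dvd_mul_left k p))

theorem exists_isOrdering_adjoinRoot {a b : L} {p : Polynomial L} (hp : Irreducible p)
    (hab : p.eval a * p.eval b < 0) :
    ∃ O : RingPreordering (AdjoinRoot p), O.IsOrdering ∧ ∀ c, 0 ≤ c → AdjoinRoot.of p c ∈ O := by
  let T : RingPreordering (AdjoinRoot p) :=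
    { toSubsemiring := (weightedSumSq L).map (AdjoinRoot.mk p)
      mem_of_isSquare' := by
        rintro _ ⟨y, rfl⟩
        obtain ⟨h, rfl⟩ := AdjoinRoot.mk_surjective y
        exact ⟨Polynomial.C 1 * h ^ 2, C_mul_sq_mem_weightedSumSq zero_le_one h, by simp [sq]⟩
      neg_one_notMem' := by
        rintro ⟨s, hs, h⟩
        refine not_dvd_one_add_of_eval_mul_eval_neg hp hab hs (AdjoinRoot.mk_eq_zero.1 ?_)
        rw [map_add, map_one]
        exact (congrArg (1 + ·) h).trans (by simp) }
  obtain ⟨O, hO, hO'⟩ := T.exists_le_isOrdering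
  exact ⟨O, hO', fun c hc => hO ⟨Polynomial.C c * 1 ^ 2, C_mul_sq_mem_weightedSumSq hc 1,
    by simp⟩⟩

end WeightedSquares

theorem IsFieldCone.polyIVT_subfield {Ω : Type*} [Field Ω] [IsAlgClosed Ω] {P : Subsemiring Ω}
    (hP : Maximal IsFieldCone P) [LinearOrder hP.prop.subfield]
    [IsStrictOrderedRing hP.prop.subfield]
    (hpos : ∀ x : hP.prop.subfield, 0 ≤ x ↔ (x : Ω) ∈ P) : PolyIVT hP.prop.subfield := by
  intro q a b hab hq
  obtain ⟨p, hp, hpq, hpab⟩ := exists_irreducible_dvd_eval_mul_eval_neg hq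
  obtain ⟨O, hO, hOc⟩ := exists_isOrdering_adjoinRoot hp hpab
  have : Fact (Irreducible p) := ⟨hp⟩
  obtain ⟨α, hα⟩ := IsAlgClosed.exists_eval₂_eq_zero hP.prop.subfield.subtype p hp.degree_pos.ne'
  let ψ := AdjoinRoot.lift hP.prop.subfield.subtype α hα
  have hle : O.toSubsemiring.map ψ ≤ P := by
    refine hP.le_of_ge (IsFieldCone.map_ordering ψ O) fun x hx => ?_
    exact ⟨_, hOc ⟨x, .inl hx⟩ ((hpos _).2 hx), AdjoinRoot.lift_of hα⟩
  have hαL : α ∈ hP.prop.subfield := by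
    refine (mem_or_neg_mem O (AdjoinRoot.root p)).imp (fun h => hle ⟨_, h, ?_⟩)
      (fun h => hle ⟨_, h, ?_⟩)
    · exact AdjoinRoot.lift_root hα
    · rw [map_neg]
      exact congrArg Neg.neg (AdjoinRoot.lift_root hα)
  have hroot : p.eval ⟨α, hαL⟩ = 0 := by
    apply hP.prop.subfield.subtype.injective
    rw [map_zero, ← hα, ← Polynomial.eval₂_at_apply]
    rfl
  obtain ⟨k, hk⟩ := Polynomial.dvd_iff_isRoot.2 hroot
  have hku := (hp.isUnit_or_isUnit hk).resolve_left (Polynomial.not_isUnit_X_sub_C _)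
  obtain ⟨u, _, rfl⟩ := Polynomial.isUnit_iff.1 hku
  generalize (⟨α, hαL⟩ : hP.prop.subfield) = c at *
  have h1 : (a - c) * (b - c) * u ^ 2 < 0 := by
    rw [hk] at hpab
    simp only [Polynomial.eval_mul, Polynomial.eval_sub, Polynomial.eval_X,
      Polynomial.eval_C] at hpab
    linear_combination hpab
  have h2 : (a - c) * (b - c) < 0 := by
    by_contra h
    exact h1.not_ge (mul_nonneg (not_lt.1 h) (sq_nonneg u))
  refine ⟨c, ?_, ?_, ?_⟩
  · by_contra h
    exact h2.not_ge (mul_nonneg (by linarith) (by linarith))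
  · by_contra h
    exact h2.not_ge (mul_nonneg_of_nonpos_of_nonpos (by linarith) (by linarith))
  · exact Polynomial.eval_eq_zero_of_dvd_of_eval_eq_zero hpq hroot

theorem RingPreordering.IsOrdering.exists_polyIVT_field.{u} {F : Type u} [Field F]
    (O : RingPreordering F) [O.IsOrdering] :
    ∃ (R : Type u) (_ : Field R) (_ : LinearOrder R) (_ : IsStrictOrderedRing R) (φ : F →+* R),
      PolyIVT R ∧ ∀ x ∈ O, 0 ≤ φ x := by
  let ψ := algebraMap F (AlgebraicClosure F)
  obtain ⟨P, hle, hP⟩ := (IsFieldCone.map_ordering ψ O).exists_maximal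
  obtain ⟨_, _, hpos⟩ := hP.prop.exists_linearOrder
  refine ⟨hP.prop.subfield, inferInstance, inferInstance, inferInstance,
    ψ.codRestrict hP.prop.subfield fun x => ?_, IsFieldCone.polyIVT_subfield hP hpos, ?_⟩
  · refine (mem_or_neg_mem O x).imp (fun h => hle ⟨x, h, rfl⟩) fun h => hle ⟨_, h, map_neg _ _⟩
  · exact fun x hx => (hpos _).2 (hle ⟨x, hx, rfl⟩)

theorem RingPreordering.exists_map_mem_of_forall_eq_div {A K : Type*} [CommRing A] [Field K]
    (O : RingPreordering A) [hO : O.IsOrdering] (ψ : A →+* K)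
    (hψ : ∀ x, ψ x = 0 ↔ x ∈ O.support) (hsurj : ∀ z, ∃ a b, ψ b ≠ 0 ∧ z = ψ a / ψ b) :
    ∃ T : RingPreordering K, ∀ x ∈ O, ψ x ∈ T := by
  refine ⟨RingPreordering.mk'
    {z | ∃ a ∈ O, ∃ b, ψ b ≠ 0 ∧ z = ψ a / ψ b ^ 2}
    (by
      rintro _ _ ⟨a, ha, b, hb, rfl⟩ ⟨c, hc, d, hd, rfl⟩
      refine ⟨a * d ^ 2 + c * b ^ 2, add_mem (mul_mem ha (O.pow_two_mem d))
        (mul_mem hc (O.pow_two_mem b)), b * d, by simp [hb, hd], ?_⟩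
      simp only [map_add, map_mul, map_pow]
      field_simp)
    (by
      rintro _ _ ⟨a, ha, b, hb, rfl⟩ ⟨c, hc, d, hd, rfl⟩
      refine ⟨a * c, mul_mem ha hc, b * d, by simp [hb, hd], ?_⟩
      simp only [map_mul]
      field_simp)
    (fun z => by
      obtain ⟨a, b, hb, rfl⟩ := hsurj z
      refine ⟨a * a, O.mul_self_mem a, b, hb, ?_⟩
      rw [map_mul]
      field_simp)
    (by
      rintro ⟨a, ha, b, hb, h⟩
      refine hb ((hψ b).2 (Ideal.IsPrime.mem_of_pow_mem hO.toIsPrime 2 ?_))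
      have h1 : a + b ^ 2 ∈ O.support := by
        rw [← hψ, map_add, map_pow]
        field_simp at h
        linear_combination -h
      refine ⟨O.pow_two_mem b, ?_⟩
      have : -(b ^ 2) = a + -(a + b ^ 2) := by ring
      rw [Set.mem_neg, this]
      exact add_mem ha h1.2), fun x hx => ⟨x, hx, 1, by simp, by simp⟩⟩

/-- A preordering of a commutative ring is non-negative under some homomorphism to an ordered
field with the intermediate value property. -/
theorem RingPreordering.exists_polyIVT_field.{u} {A : Type u} [CommRing A] (P : RingPreordering A) :
    ∃ (R : Type u) (_ : Field R) (_ : LinearOrder R) (_ : IsStrictOrderedRing R) (φ : A →+* R),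
      PolyIVT R ∧ ∀ x ∈ P, 0 ≤ φ x := by
  obtain ⟨O, hPO, hO⟩ := P.exists_le_isOrdering
  let K := FractionRing (A ⧸ O.support)
  let ψ : A →+* K := (algebraMap (A ⧸ O.support) K).comp (Ideal.Quotient.mk O.support)
  have hψ : ∀ x, ψ x = 0 ↔ x ∈ O.support := fun x => by
    rw [← Ideal.Quotient.eq_zero_iff_mem]
    exact map_eq_zero_iff _ (IsFractionRing.injective (A ⧸ O.support) K)
  have hsurj : ∀ z, ∃ a b, ψ b ≠ 0 ∧ z = ψ a / ψ b := fun z => by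
    obtain ⟨x, y, hy, rfl⟩ := IsFractionRing.div_surjective (A ⧸ O.support) z
    obtain ⟨a, rfl⟩ := Ideal.Quotient.mk_surjective x
    obtain ⟨b, rfl⟩ := Ideal.Quotient.mk_surjective y
    refine ⟨a, b, fun h => nonZeroDivisors.ne_zero hy ?_, rfl⟩
    rw [Ideal.Quotient.eq_zero_iff_mem]
    exact (hψ b).1 h
  obtain ⟨T, hT⟩ := O.exists_map_mem_of_forall_eq_div ψ hψ hsurj
  obtain ⟨O', hTO', hO'⟩ := T.exists_le_isOrdering
  obtain ⟨R, _, _, _, φ, hR, hφ⟩ := RingPreordering.IsOrdering.exists_polyIVT_field O'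
  exact ⟨R, inferInstance, inferInstance, inferInstance, φ.comp ψ, hR, fun x hx =>
    hφ _ (hTO' (hT x (hPO hx)))⟩

section Closure

variable {σ ι : Type*}

theorem isSOS_iff_isSumSq {p : MvPolynomial σ ℝ} : IsSOS p ↔ IsSumSq p := by
  constructor
  · rintro ⟨k, q, rfl⟩
    exact IsSumSq.sum fun i _ => (IsSquare.sq (q i)).isSumSq
  · intro h
    induction h with
    | zero => exact ⟨0, Fin.elim0, by simp⟩
    | @sq_add a s _ ih =>
      obtain ⟨k, q, rfl⟩ := ih
      exact ⟨k + 1, Fin.cons a q, by simp [Fin.sum_univ_succ, sq]⟩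

theorem IsSOS.zero : IsSOS (0 : MvPolynomial σ ℝ) := isSOS_iff_isSumSq.2 .zero

theorem IsSOS.sq (p : MvPolynomial σ ℝ) : IsSOS (p ^ 2) := ⟨1, fun _ => p, by simp⟩

theorem IsSOS.add {p q : MvPolynomial σ ℝ} (hp : IsSOS p) (hq : IsSOS q) : IsSOS (p + q) :=
  isSOS_iff_isSumSq.2 ((isSOS_iff_isSumSq.1 hp).add (isSOS_iff_isSumSq.1 hq))

theorem IsSOS.mul {p q : MvPolynomial σ ℝ} (hp : IsSOS p) (hq : IsSOS q) : IsSOS (p * q) :=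
  isSOS_iff_isSumSq.2 ((isSOS_iff_isSumSq.1 hp).mul (isSOS_iff_isSumSq.1 hq))

theorem IsSOS.C {r : ℝ} (hr : 0 ≤ r) : IsSOS (C r : MvPolynomial σ ℝ) := by
  simpa [← map_pow, Real.sq_sqrt hr] using IsSOS.sq (MvPolynomial.C (√r) : MvPolynomial σ ℝ)

variable [Fintype ι] {g : ι → MvPolynomial σ ℝ}

theorem InQM.add {p q : MvPolynomial σ ℝ} (hp : InQM g p) (hq : InQM g q) : InQM g (p + q) := by
  obtain ⟨s0, s, h0, h, rfl⟩ := hp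
  obtain ⟨t0, t, h0', h', rfl⟩ := hq
  refine ⟨s0 + t0, fun j => s j + t j, h0.add h0', fun j => (h j).add (h' j), ?_⟩
  simp only [add_mul, Finset.sum_add_distrib]
  ring

theorem InQM.sos_mul {p s : MvPolynomial σ ℝ} (hs : IsSOS s) (hp : InQM g p) :
    InQM g (s * p) := by
  obtain ⟨t0, t, h0, h, rfl⟩ := hp
  refine ⟨s * t0, fun j => s * t j, hs.mul h0, fun j => hs.mul (h j), ?_⟩
  simp only [mul_add, Finset.mul_sum, mul_assoc]

theorem IsSOS.inQM {s : MvPolynomial σ ℝ} (hs : IsSOS s) : InQM g s :=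
  ⟨s, 0, hs, fun _ => .zero, by simp⟩

theorem IsSOS.rename {τ : Type*} {s : MvPolynomial σ ℝ} (hs : IsSOS s) (e : σ → τ) :
    IsSOS (rename e s) := by
  obtain ⟨k, q, rfl⟩ := hs
  exact ⟨k, fun i => MvPolynomial.rename e (q i), by simp⟩

theorem InQM.rename {τ : Type*} {p : MvPolynomial σ ℝ} (hp : InQM g p) (e : σ → τ) :
    InQM (fun j => rename e (g j)) (rename e p) := by
  obtain ⟨s0, s, h0, h, rfl⟩ := hp
  exact ⟨_, fun j => MvPolynomial.rename e (s j), h0.rename e, fun j => (h j).rename e, by simp⟩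

theorem inQM_self (j : ι) : InQM g (g j) := by
  classical
  refine ⟨0, Pi.single j 1, .zero, fun k => ?_, ?_⟩
  · by_cases h : k = j
    · subst h
      simpa using IsSOS.sq (1 : MvPolynomial σ ℝ)
    · simpa [h] using IsSOS.zero
  · simp [Pi.single_apply]

variable [DecidableEq ι]

theorem InPre.add {p q : MvPolynomial σ ℝ} (hp : InPre g p) (hq : InPre g q) :
    InPre g (p + q) := by
  obtain ⟨s, h, rfl⟩ := hp
  obtain ⟨t, h', rfl⟩ := hq
  refine ⟨fun A => s A + t A, fun A => (h A).add (h' A), ?_⟩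
  simp only [add_mul, Finset.sum_add_distrib]

theorem InPre.zero : InPre g 0 := ⟨0, fun _ => .zero, by simp⟩

theorem InPre.sum {α : Type*} {s : Finset α} {p : α → MvPolynomial σ ℝ}
    (h : ∀ a ∈ s, InPre g (p a)) : InPre g (∑ a ∈ s, p a) :=
  Finset.sum_induction _ _ (fun _ _ => InPre.add) InPre.zero h

theorem IsSOS.inPre_mul_prod {s : MvPolynomial σ ℝ} (hs : IsSOS s) (A : Finset ι) :
    InPre g (s * ∏ j ∈ A, g j) := by
  refine ⟨Pi.single A s, fun B => ?_, ?_⟩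
  · by_cases h : B = A
    · subst h
      simpa using hs
    · simpa [h] using IsSOS.zero
  · simp [Pi.single_apply]

theorem IsSOS.inPre {s : MvPolynomial σ ℝ} (hs : IsSOS s) : InPre g s := by
  simpa using hs.inPre_mul_prod (g := g) ∅

theorem inPre_self (j : ι) : InPre g (g j) := by
  simpa using (IsSOS.sq 1).inPre_mul_prod (g := g) {j}

theorem InPre.mul {p q : MvPolynomial σ ℝ} (hp : InPre g p) (hq : InPre g q) :
    InPre g (p * q) := by
  obtain ⟨s, h, rfl⟩ := hp
  obtain ⟨t, h', rfl⟩ := hq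
  rw [Finset.sum_mul_sum]
  refine InPre.sum fun A _ => InPre.sum fun B _ => ?_
  have : s A * (∏ j ∈ A, g j) * (t B * ∏ j ∈ B, g j)
      = s A * t B * (∏ j ∈ A ∩ B, g j) ^ 2 * ∏ j ∈ (A ∪ B) \ (A ∩ B), g j := by
    have h1 := Finset.prod_union_inter (s₁ := A) (s₂ := B) (f := g)
    have h2 := Finset.prod_sdiff (f := g)
      (Finset.inter_subset_left.trans Finset.subset_union_left : A ∩ B ⊆ A ∪ B)
    rw [← h2] at h1
    linear_combination - s A * t B * h1
  rw [this]
  exact (((h A).mul (h' B)).mul (IsSOS.sq _)).inPre_mul_prod _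

end Closure

/-- The Positivstellensatz: an empty semi-algebraic set has an algebraic certificate. -/
theorem exists_inPre_add_one_mem_span {σ ι κ : Type*} [Fintype σ] [Fintype ι] [DecidableEq ι]
    [Finite κ] (g : ι → MvPolynomial σ ℝ) (h : κ → MvPolynomial σ ℝ)
    (hempty : ∀ b : σ → ℝ, (∀ j, 0 ≤ eval b (g j)) → (∀ k, eval b (h k) = 0) → False) :
    ∃ p, InPre g p ∧ p + 1 ∈ Ideal.span (Set.range h) := by
  classical
  have := Fintype.ofFinite κ
  by_contra! hcon
  let N : Subsemiring (MvPolynomial σ ℝ) :=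
    { carrier := {p | InPre g p}
      mul_mem' := InPre.mul
      one_mem' := by simpa using (IsSOS.sq (1 : MvPolynomial σ ℝ)).inPre (g := g)
      add_mem' := InPre.add
      zero_mem' := InPre.zero }
  let T : RingPreordering (MvPolynomial σ ℝ ⧸ Ideal.span (Set.range h)) :=
    { toSubsemiring := N.map (Ideal.Quotient.mk _)
      mem_of_isSquare' := by
        rintro _ ⟨y, rfl⟩
        obtain ⟨a, rfl⟩ := Ideal.Quotient.mk_surjective y
        exact ⟨a ^ 2, (IsSOS.sq a).inPre, by simp [sq]⟩
      neg_one_notMem' := by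
        rintro ⟨s, hs, e⟩
        refine hcon s hs (Ideal.Quotient.eq_zero_iff_mem.1 ?_)
        rw [map_add, map_one]
        exact (congrArg (· + 1) e).trans (by simp) }
  obtain ⟨R, _, _, _, φ, hR, hφ⟩ := T.exists_polyIVT_field
  have hspan : ∀ k, φ (Ideal.Quotient.mk (Ideal.span (Set.range h)) (h k)) = 0 := fun k => by
    rw [Ideal.Quotient.eq_zero_iff_mem.2 (Ideal.subset_span (Set.mem_range_self k)), map_zero]
  obtain ⟨b, hb⟩ := exists_eval_nonneg hR (φ.comp (Ideal.Quotient.mk _))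
    (Finset.univ.image g ∪ (Finset.univ.image h ∪ Finset.univ.image (-h))) (by
      intro p hp
      simp only [Finset.mem_union, Finset.mem_image, Finset.mem_univ, true_and] at hp
      rcases hp with ⟨j, rfl⟩ | ⟨k, rfl⟩ | ⟨k, rfl⟩
      · exact hφ _ ⟨_, inPre_self j, rfl⟩
      · exact (hspan k).ge
      · rw [Pi.neg_apply, map_neg, RingHom.comp_apply, hspan, neg_zero])
  refine hempty b (fun j => hb _ (by simp)) fun k => le_antisymm ?_ (hb _ (by simp))
  have := hb (-h k) (by simp)
  rw [map_neg] at this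
  linarith

/-- An additive submonoid containing `1` and closed under multiplication by squares. -/
structure IsQuadraticModule {A : Type*} [CommRing A] (M : AddSubmonoid A) : Prop where
  one_mem : 1 ∈ M
  sq_mul_mem : ∀ a, ∀ m ∈ M, a ^ 2 * m ∈ M

namespace IsQuadraticModule

variable {A : Type*} [CommRing A] {M : AddSubmonoid A}

theorem sq_mem (hM : IsQuadraticModule M) (a : A) : a ^ 2 ∈ M := by
  simpa using hM.sq_mul_mem a 1 hM.one_mem

theorem isSumSq_mul_mem (hM : IsQuadraticModule M) {s m : A} (hs : IsSumSq s) (hm : m ∈ M) :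
    s * m ∈ M := by
  induction hs with
  | zero => simp
  | sq_add a _ ih =>
    rw [add_mul, ← sq]
    exact add_mem (hM.sq_mul_mem a m hm) ih

theorem isSumSq_mem (hM : IsQuadraticModule M) {s : A} (hs : IsSumSq s) : s ∈ M := by
  simpa using hM.isSumSq_mul_mem hs hM.one_mem

/-- The quadratic module obtained by adjoining an element. -/
def adjoin (M : AddSubmonoid A) (a : A) : AddSubmonoid A where
  carrier := {x | ∃ m ∈ M, ∃ s, IsSumSq s ∧ x = m + a * s}
  zero_mem' := ⟨0, zero_mem M, 0, .zero, by simp⟩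
  add_mem' := by
    rintro _ _ ⟨m, hm, s, hs, rfl⟩ ⟨m', hm', s', hs', rfl⟩
    exact ⟨m + m', add_mem hm hm', s + s', hs.add hs', by ring⟩

theorem isQuadraticModule_adjoin (hM : IsQuadraticModule M) (a : A) :
    IsQuadraticModule (adjoin M a) where
  one_mem := ⟨1, hM.one_mem, 0, .zero, by simp⟩
  sq_mul_mem := by
    rintro b _ ⟨m, hm, s, hs, rfl⟩
    exact ⟨b ^ 2 * m, hM.sq_mul_mem b m hm, b ^ 2 * s, (IsSquare.sq b).isSumSq.mul hs, by ring⟩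

variable [Algebra ℝ A]

theorem algebraMap_mem (hM : IsQuadraticModule M) {r : ℝ} (hr : 0 ≤ r) :
    algebraMap ℝ A r ∈ M := by
  simpa [← map_pow, Real.sq_sqrt hr] using hM.sq_mem (algebraMap ℝ A (√r))

theorem algebraMap_mul_mem (hM : IsQuadraticModule M) {r : ℝ} (hr : 0 ≤ r) {m : A} (hm : m ∈ M) :
    algebraMap ℝ A r * m ∈ M := by
  simpa [← map_pow, Real.sq_sqrt hr] using hM.sq_mul_mem (algebraMap ℝ A (√r)) m hm

theorem nonneg_of_algebraMap_mem (hM : IsQuadraticModule M) (h1 : -1 ∉ M) {r : ℝ}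
    (h : algebraMap ℝ A r ∈ M) : 0 ≤ r := by
  by_contra! hr
  refine h1 ?_
  have := hM.algebraMap_mul_mem (r := (-r)⁻¹) (by simpa using hr.le) h
  rw [← map_mul] at this
  have e : (-r)⁻¹ * r = -1 := by
    rw [inv_neg, neg_mul, inv_mul_cancel₀ hr.ne]
  rwa [e, map_neg, map_one] at this

/-- Every element is a difference of two squares. -/
theorem eq_sq_sub_sq (a : A) : ∃ b c : A, a = b ^ 2 - c ^ 2 := by
  have h2 : algebraMap ℝ A 2⁻¹ * 2 = 1 := by
    rw [← map_ofNat (algebraMap ℝ A) 2, ← map_mul]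
    simp
  refine ⟨algebraMap ℝ A 2⁻¹ * (a + 1), algebraMap ℝ A 2⁻¹ * (a - 1), ?_⟩
  linear_combination (-a * algebraMap ℝ A 2⁻¹ * 2 - a) * h2

theorem mul_mem_of_mem_of_neg_mem (hM : IsQuadraticModule M) {a x : A} (hx : x ∈ M)
    (hx' : -x ∈ M) : a * x ∈ M := by
  obtain ⟨b, c, rfl⟩ := eq_sq_sub_sq a
  have := add_mem (hM.sq_mul_mem b x hx) (hM.sq_mul_mem c _ hx')
  convert this using 1
  ring

/-- A proper quadratic module is contained in a proper total one. -/
theorem exists_le_total (hM : IsQuadraticModule M) (h1 : -1 ∉ M) :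
    ∃ N : AddSubmonoid A, M ≤ N ∧ IsQuadraticModule N ∧ -1 ∉ N ∧ ∀ a, a ∈ N ∨ -a ∈ N := by
  obtain ⟨N, hMN, hN⟩ := zorn_le_nonempty₀ {N : AddSubmonoid A | IsQuadraticModule N ∧ -1 ∉ N}
    (fun c hc hchain y hy => by
      have hmem : ∀ x, x ∈ sSup c ↔ ∃ s ∈ c, x ∈ s := fun x =>
        AddSubmonoid.mem_sSup_of_directedOn ⟨y, hy⟩ hchain.directedOn
      refine ⟨sSup c, ⟨⟨(hmem _).2 ⟨y, hy, (hc hy).1.one_mem⟩, fun a m hm => ?_⟩, fun h => ?_⟩,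
        fun z hz x hx => (hmem x).2 ⟨z, hz, hx⟩⟩
      · obtain ⟨s, hs, hm⟩ := (hmem _).1 hm
        exact (hmem _).2 ⟨s, hs, (hc hs).1.sq_mul_mem a m hm⟩
      · obtain ⟨s, hs, h⟩ := (hmem _).1 h
        exact (hc hs).2 h) M ⟨hM, h1⟩
  obtain ⟨hq, hneg⟩ := hN.prop
  refine ⟨N, hMN, hq, hneg, fun a => ?_⟩
  have key : ∀ a ∉ N, ∃ m ∈ N, ∃ s, IsSumSq s ∧ -1 = m + a * s := by
    intro a ha
    by_contra hcon
    refine ha (hN.le_of_ge (y := adjoin N a) ⟨hq.isQuadraticModule_adjoin a, hcon⟩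
      (fun m hm => ⟨m, hm, 0, .zero, by simp⟩) ⟨0, zero_mem N, 1, IsSquare.one.isSumSq, by simp⟩)
  by_contra! h
  obtain ⟨m, hm, s, hs, e⟩ := key a h.1
  obtain ⟨m', hm', s', hs', e'⟩ := key (-a) h.2
  have hneg_s : -s ∈ N := by
    have : -s = s' + (s' * m + s * m') := by linear_combination s' * e + s * e'
    rw [this]
    exact add_mem (hq.isSumSq_mem hs') (add_mem (hq.isSumSq_mul_mem hs' hm)
      (hq.isSumSq_mul_mem hs hm'))
  refine hneg ?_
  rw [e]
  exact add_mem hm (hq.mul_mem_of_mem_of_neg_mem (hq.isSumSq_mem hs) hneg_s)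

/-- The ideal of infinitesimal elements of an archimedean quadratic module. -/
def infinitesimals (hM : IsQuadraticModule M)
    (harch : ∀ a : A, ∃ N : ℝ, algebraMap ℝ A N - a ∈ M) : Ideal A where
  carrier := {a | ∀ ε : ℝ, 0 < ε → algebraMap ℝ A ε - a ∈ M ∧ algebraMap ℝ A ε + a ∈ M}
  zero_mem' := fun ε hε => by simpa using hM.algebraMap_mem hε.le
  add_mem' := by
    intro a b ha hb ε hε
    have e : algebraMap ℝ A ε = algebraMap ℝ A (ε / 2) + algebraMap ℝ A (ε / 2) := by
      rw [← map_add, add_halves]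
    obtain ⟨h1, h2⟩ := ha (ε / 2) (half_pos hε)
    obtain ⟨h3, h4⟩ := hb (ε / 2) (half_pos hε)
    rw [e]
    constructor
    · convert add_mem h1 h3 using 1
      ring
    · convert add_mem h2 h4 using 1
      ring
  smul_mem' := by
    intro x a ha ε hε
    obtain ⟨b, c, rfl⟩ := eq_sq_sub_sq x
    obtain ⟨N, hN⟩ := harch (b ^ 2 + c ^ 2)
    set δ := ε / (|N| + 1) with hδ
    have hδ0 : 0 < δ := by positivity
    have hle : δ * N ≤ ε := by
      rw [hδ, div_mul_eq_mul_div, div_le_iff₀ (by positivity)]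
      nlinarith [le_abs_self N]
    obtain ⟨h1, h2⟩ := ha δ hδ0
    have h3 := add_mem (hM.algebraMap_mem (sub_nonneg.2 hle)) (hM.algebraMap_mul_mem hδ0.le hN)
    rw [map_sub, map_mul] at h3
    constructor
    · convert add_mem h3 (add_mem (hM.sq_mul_mem b _ h1) (hM.sq_mul_mem c _ h2)) using 1
      rw [smul_eq_mul]
      ring
    · convert add_mem h3 (add_mem (hM.sq_mul_mem b _ h2) (hM.sq_mul_mem c _ h1)) using 1
      rw [smul_eq_mul]
      ring

/-- A proper archimedean quadratic module is nonnegative under some real point. -/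
theorem exists_ringHom_real (hM : IsQuadraticModule M) (h1 : -1 ∉ M)
    (harch : ∀ a : A, ∃ N : ℝ, algebraMap ℝ A N - a ∈ M) :
    ∃ φ : A →+* ℝ, ∀ m ∈ M, 0 ≤ φ m := by
  obtain ⟨N, hMN, hN, hneg, htot⟩ := hM.exists_le_total h1
  have harch' : ∀ a : A, ∃ r : ℝ, algebraMap ℝ A r - a ∈ N := fun a =>
    (harch a).imp fun _ h => hMN h
  set J := hN.infinitesimals harch' with hJ
  have hJ1 : J ≠ ⊤ := by
    rw [Ne, Ideal.eq_top_iff_one]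
    intro h
    have := (h 2⁻¹ (by norm_num)).1
    rw [← map_one (algebraMap ℝ A), ← map_sub] at this
    have := hN.nonneg_of_algebraMap_mem hneg this
    norm_num at this
  have : Nontrivial (A ⧸ J) := Ideal.Quotient.nontrivial_iff.2 hJ1
  have hex : ∀ a : A, ∃ c : ℝ, a - algebraMap ℝ A c ∈ J := by
    intro a
    obtain ⟨u, hu⟩ := harch' a
    obtain ⟨l, hl⟩ := harch' (-a)
    set S := {r : ℝ | a - algebraMap ℝ A r ∈ N} with hS
    have hne : S.Nonempty := ⟨-l, by simpa [hS, add_comm] using hl⟩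
    have hbdd : BddAbove S := by
      refine ⟨u, fun r hr => ?_⟩
      have := add_mem hu hr
      rw [sub_add_sub_cancel, ← map_sub] at this
      exact sub_nonneg.1 (hN.nonneg_of_algebraMap_mem hneg this)
    refine ⟨sSup S, fun ε hε => ⟨?_, ?_⟩⟩
    · refine (htot _).resolve_right fun h => ?_
      have : sSup S + ε ∈ S := by
        rw [hS, Set.mem_ofPred_eq, map_add]
        convert h using 1
        ring
      linarith [le_csSup hbdd this]
    · obtain ⟨r, hr, hlt⟩ := exists_lt_of_lt_csSup hne (sub_lt_self (sSup S) hε)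
      have := add_mem hr (hN.algebraMap_mem (r := r - sSup S + ε) (by linarith))
      rw [map_add, map_sub] at this
      convert this using 1
      ring
  have hbij : Function.Bijective (algebraMap ℝ (A ⧸ J)) := by
    refine ⟨RingHom.injective _, fun y => ?_⟩
    obtain ⟨a, rfl⟩ := Ideal.Quotient.mk_surjective y
    obtain ⟨c, hc⟩ := hex a
    exact ⟨c, (Ideal.Quotient.eq.2 hc).symm⟩
  let e := RingEquiv.ofBijective _ hbij
  refine ⟨(e.symm : A ⧸ J →+* ℝ).comp (Ideal.Quotient.mk J), fun m hm => ?_⟩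
  obtain ⟨c, hc⟩ := hex m
  have hφ : e.symm (Ideal.Quotient.mk J m) = c :=
    e.symm_apply_eq.2 (Ideal.Quotient.eq.2 hc)
  change 0 ≤ e.symm (Ideal.Quotient.mk J m)
  rw [hφ]
  by_contra! hneg_c
  have h2 := add_mem (hMN hm) (hc (-c / 2) (by linarith)).1
  have h3 : m + (algebraMap ℝ A (-c / 2) - (m - algebraMap ℝ A c)) = algebraMap ℝ A (c / 2) := by
    have : algebraMap ℝ A (c / 2) = algebraMap ℝ A (-c / 2) + algebraMap ℝ A c := by
      rw [← map_add]
      congr 1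
      ring
    rw [this]
    ring
  rw [h3] at h2
  linarith [hN.nonneg_of_algebraMap_mem hneg h2]

/-- The elements bounded with respect to a quadratic module form a subalgebra. -/
def boundedElements (hM : IsQuadraticModule M) : Subalgebra ℝ A where
  carrier := {a | ∃ N : ℝ, 0 < N ∧ algebraMap ℝ A N - a ∈ M ∧ algebraMap ℝ A N + a ∈ M}
  algebraMap_mem' r := by
    refine ⟨|r| + 1, by positivity, ?_, ?_⟩
    · rw [← map_sub]
      exact hM.algebraMap_mem (by linarith [le_abs_self r])
    · rw [← map_add]
      exact hM.algebraMap_mem (by linarith [neg_abs_le r])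
  add_mem' := by
    rintro a b ⟨N, hN0, h1, h2⟩ ⟨N', hN0', h3, h4⟩
    refine ⟨N + N', by positivity, ?_, ?_⟩
    · rw [map_add]
      convert add_mem h1 h3 using 1
      ring
    · rw [map_add]
      convert add_mem h2 h4 using 1
      ring
  mul_mem' := by
    have hsq : ∀ (a : A) (N : ℝ), 0 < N → algebraMap ℝ A N - a ∈ M → algebraMap ℝ A N + a ∈ M →
        algebraMap ℝ A (N ^ 2) - a ^ 2 ∈ M := by
      intro a N hN h1 h2
      have h3 := hM.algebraMap_mul_mem (r := (2 * N)⁻¹) (by positivity)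
        (add_mem (hM.sq_mul_mem (algebraMap ℝ A N + a) _ h1)
          (hM.sq_mul_mem (algebraMap ℝ A N - a) _ h2))
      have e : algebraMap ℝ A (2 * N)⁻¹ * (2 * algebraMap ℝ A N) = 1 := by
        rw [← map_ofNat (algebraMap ℝ A) 2, ← map_mul, ← map_mul, inv_mul_cancel₀ (by positivity),
          map_one]
      convert h3 using 1
      rw [map_pow]
      linear_combination -(algebraMap ℝ A N ^ 2 - a ^ 2) * e
    rintro a b ⟨N, hN0, h1, h2⟩ ⟨N', hN0', h3, h4⟩
    have h5 := hsq (a + b) (N + N') (by positivity)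
      (by rw [map_add]; convert add_mem h1 h3 using 1; ring)
      (by rw [map_add]; convert add_mem h2 h4 using 1; ring)
    have h6 := hsq (a - b) (N + N') (by positivity)
      (by rw [map_add]; convert add_mem h1 h4 using 1; ring)
      (by rw [map_add]; convert add_mem h2 h3 using 1; ring)
    have e : algebraMap ℝ A 4⁻¹ * 4 = 1 := by
      rw [← map_ofNat (algebraMap ℝ A) 4, ← map_mul]
      simp
    refine ⟨4⁻¹ * (N + N') ^ 2, by positivity, ?_, ?_⟩
    · convert hM.algebraMap_mul_mem (r := 4⁻¹) (by norm_num)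
        (add_mem h5 (hM.sq_mem (a - b))) using 1
      rw [map_mul]
      linear_combination a * b * e
    · convert hM.algebraMap_mul_mem (r := 4⁻¹) (by norm_num)
        (add_mem h6 (hM.sq_mem (a + b))) using 1
      rw [map_mul]
      linear_combination -a * b * e

theorem mem_boundedElements_of_sub_sq_mem (hM : IsQuadraticModule M) {a : A} {R : ℝ} (hR : 0 ≤ R)
    (h : algebraMap ℝ A R - a ^ 2 ∈ M) : a ∈ hM.boundedElements := by
  have e : algebraMap ℝ A 2⁻¹ * 2 = 1 := by
    rw [← map_ofNat (algebraMap ℝ A) 2, ← map_mul]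
    simp
  refine ⟨R + 2⁻¹ ^ 2, by positivity, ?_, ?_⟩
  · convert add_mem h (hM.sq_mem (a - algebraMap ℝ A 2⁻¹)) using 1
    rw [map_add, map_pow]
    linear_combination a * e
  · convert add_mem h (hM.sq_mem (a + algebraMap ℝ A 2⁻¹)) using 1
    rw [map_add, map_pow]
    linear_combination -a * e

end IsQuadraticModule

/-- An archimedean quadratic module with empty real zero set modulo an ideal contains `-1`
modulo that ideal. -/
theorem exists_inQM_add_one_mem {σ ι : Type*} [Fintype ι] (g : ι → MvPolynomial σ ℝ)
    (I : Ideal (MvPolynomial σ ℝ)) {R : ℝ} (hR : 0 ≤ R)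
    (harch : ∀ i : σ, ∃ q, InQM g q ∧ C R - X i ^ 2 - q ∈ I)
    (hempty : ∀ b : σ → ℝ, (∀ j, 0 ≤ eval b (g j)) → (∀ p ∈ I, eval b p = 0) → False) :
    ∃ p, InQM g p ∧ p + 1 ∈ I := by
  let M : AddSubmonoid (MvPolynomial σ ℝ) :=
    { carrier := {p | ∃ q, InQM g q ∧ p - q ∈ I}
      zero_mem' := ⟨0, IsSOS.zero.inQM, by simp⟩
      add_mem' := by
        rintro a b ⟨p, hp, hp'⟩ ⟨q, hq, hq'⟩
        refine ⟨p + q, hp.add hq, ?_⟩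
        rw [add_sub_add_comm]
        exact add_mem hp' hq' }
  have hM : IsQuadraticModule M :=
    ⟨⟨1, by simpa using (IsSOS.sq (1 : MvPolynomial σ ℝ)).inQM, by simp⟩, by
      rintro a p ⟨q, hq, hpq⟩
      refine ⟨a ^ 2 * q, hq.sos_mul (.sq a), ?_⟩
      rw [← mul_sub]
      exact I.mul_mem_left _ hpq⟩
  by_contra! hcon
  have h1 : -1 ∉ M := by
    rintro ⟨q, hq, h⟩
    refine hcon q hq ?_
    convert neg_mem h using 1
    ring
  have htop : ∀ a, a ∈ hM.boundedElements := by
    intro a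
    induction a using MvPolynomial.induction_on with
    | C r => exact hM.boundedElements.algebraMap_mem r
    | add p q hp hq => exact add_mem hp hq
    | mul_X p i hp => exact mul_mem hp (hM.mem_boundedElements_of_sub_sq_mem hR (harch i))
  obtain ⟨φ, hφ⟩ := hM.exists_ringHom_real h1 fun a => (htop a).imp fun _ h => h.2.1
  have he : φ = eval (fun i => φ (X i)) :=
    MvPolynomial.ringHom_ext (fun r => by
      rw [eval_C]
      exact DFunLike.congr_fun (Subsingleton.elim (φ.comp C) (RingHom.id ℝ)) r) (by simp)
  refine hempty (fun i => φ (X i)) (fun j => ?_) fun p hp => ?_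
  · rw [← he]
    exact hφ _ ⟨g j, inQM_self j, by simp⟩
  · rw [← he]
    refine le_antisymm ?_ (hφ _ ⟨0, IsSOS.zero.inQM, by simpa using hp⟩)
    have := hφ (-p) ⟨0, IsSOS.zero.inQM, by simpa using hp⟩
    rwa [map_neg, neg_nonneg] at this

/-- Lagrange interpolation with squared basis polynomials, inside a cone that is closed under
multiplication by sums of squares. -/
theorem exists_interpolation {σ : Type*} (K : MvPolynomial σ ℝ → Prop)
    (hadd : ∀ p q, K p → K q → K (p + q)) (hsos : ∀ s, IsSOS s → K s)
    (hmul : ∀ s p, IsSOS s → K p → K (s * p)) (F : MvPolynomial σ ℝ) {T : Set ℝ} (hT : T.Finite)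
    (V : Set (σ → ℝ)) (hV : ∀ b ∈ V, eval b F ∈ T)
    (hcert : ∀ t < 0, ∃ p, K p ∧ ∀ b ∈ V, eval b F = t → eval b p = -1) :
    ∃ q, K q ∧ ∀ b ∈ V, eval b (F - q) = 0 := by
  classical
  have hval : ∀ t : ℝ, ∃ q, K q ∧ ∀ b ∈ V, eval b F = t → eval b q = t := by
    intro t
    rcases le_or_gt 0 t with ht | ht
    · exact ⟨C t, hsos _ (.C ht), fun b _ _ => eval_C t⟩
    · obtain ⟨p, hp, hp'⟩ := hcert t ht
      refine ⟨C (-t) * p, hmul _ _ (.C (by linarith)) hp, fun b hb hbt => ?_⟩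
      rw [map_mul, eval_C, hp' b hb hbt]
      ring
  choose q hqK hq using hval
  let L : ℝ → MvPolynomial σ ℝ := fun t =>
    Polynomial.aeval F (Lagrange.basis hT.toFinset id t)
  have hL : ∀ b t, eval b (L t) = (Lagrange.basis hT.toFinset id t).eval (eval b F) := by
    intro b t
    have := Polynomial.hom_eval₂ (Lagrange.basis hT.toFinset id t) (algebraMap ℝ _) (eval b) F
    rw [← Polynomial.aeval_def] at this
    rw [this, Polynomial.eval]
    congr 1
    ext r
    simp
  refine ⟨∑ t ∈ hT.toFinset, L t ^ 2 * q t,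
    Finset.sum_induction _ K hadd (hsos 0 .zero) fun t _ => hmul _ _ (.sq _) (hqK t), ?_⟩
  intro b hb
  have hmem : eval b F ∈ hT.toFinset := hT.mem_toFinset.2 (hV b hb)
  rw [map_sub, map_sum, Finset.sum_eq_single_of_mem _ hmem, map_mul, map_pow, hL, hq _ b hb rfl]
  · have := Lagrange.eval_basis_self (v := id) Function.injective_id.injOn hmem
    rw [id] at this
    rw [this]
    ring
  · intro t _ ht
    have := Lagrange.eval_basis_of_ne (v := id) ht hmem
    rw [id] at this
    rw [map_mul, map_pow, hL, this]
    ring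

/-- If `f` is non-negative on `S(g)`, it takes no negative value there in the lifted variables. -/
theorem not_lt_zero_of_nonneg_on_Sg {n m : ℕ} {f : MvPolynomial (Fin n) ℝ}
    {g : Fin m → MvPolynomial (Fin n) ℝ} (hf : ∀ x ∈ Sg g, 0 ≤ eval x f) {t : ℝ} (ht : t < 0)
    (b : Fin n ⊕ Fin (m + 1) → ℝ) (hg : ∀ j, 0 ≤ eval b (rename Sum.inl (g j)))
    (hb : eval b (rename Sum.inl f - C t) = 0) : False := by
  rw [← Sum.elim_comp_inl_inr b] at hb hg
  simp only [map_sub, eval_C, eval_elim_rename_inl] at hb hg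
  linarith [hf _ hg]

/-- If `f` is non-negative on `S(g)` and `f(C⁺(g))` is finite, then there is
`q ∈ P(g)[x, λ̄]` such that `f − q` vanishes on `V(h_FJ⁺)`; under the Archimedean
condition one can take `q ∈ Q(g)[x, λ̄]`. -/
theorem rep_FJplus {n m : ℕ} (f : MvPolynomial (Fin n) ℝ)
    (g : Fin m → MvPolynomial (Fin n) ℝ)
    (hf : ∀ x ∈ Sg g, 0 ≤ eval x f)
    (hfin : ((fun x => eval x f) '' CplusSet g).Finite) :
    (∃ q : MvPolynomial (Fin n ⊕ Fin (m + 1)) ℝ,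
      InPre (fun j => rename Sum.inl (g j)) q ∧
      ∀ p ∈ VFJplus f g, eval (Sum.elim p.1 p.2) (rename Sum.inl f - q) = 0) ∧
    (ArchCond g → ∃ q : MvPolynomial (Fin n ⊕ Fin (m + 1)) ℝ,
      InQM (fun j => rename Sum.inl (g j)) q ∧
      ∀ p ∈ VFJplus f g, eval (Sum.elim p.1 p.2) (rename Sum.inl f - q) = 0) := by
  let h : ℝ → (Fin n ⊕ Fin m ⊕ Unit) ⊕ Unit → MvPolynomial (Fin n ⊕ Fin (m + 1)) ℝ :=
    fun t => Sum.elim (fjPoly f g) fun _ => rename Sum.inl f - C t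
  suffices H : ∀ K : MvPolynomial (Fin n ⊕ Fin (m + 1)) ℝ → Prop,
      (∀ p q, K p → K q → K (p + q)) → (∀ s, IsSOS s → K s) →
      (∀ s p, IsSOS s → K p → K (s * p)) →
      (∀ t < 0, ∃ p, K p ∧ p + 1 ∈ Ideal.span (Set.range (h t))) →
      ∃ q, K q ∧ ∀ p ∈ VFJplus f g, eval (Sum.elim p.1 p.2) (rename Sum.inl f - q) = 0 by
    refine ⟨H _ (fun _ _ => InPre.add) (fun _ hs => hs.inPre) (fun _ _ hs => hs.inPre.mul)
      fun t ht => ?_, fun ⟨R, hR, hRg⟩ => H _ (fun _ _ => InQM.add) (fun _ hs => hs.inQM)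
      (fun _ _ => InQM.sos_mul) fun t ht => ?_⟩
    · exact exists_inPre_add_one_mem_span _ _ fun b hg hb =>
        not_lt_zero_of_nonneg_on_Sg hf ht b hg (hb (.inr ()))
    · refine exists_inQM_add_one_mem (R := R + 1) _ _ (by linarith) ?_ fun b hg hb =>
        not_lt_zero_of_nonneg_on_Sg hf ht b hg
          (hb _ (Ideal.subset_span (Set.mem_range_self (Sum.inr ()))))
      have hball : InQM (fun j => rename Sum.inl (g j))
          (C R - ∑ i : Fin n, X (Sum.inl i : Fin n ⊕ Fin (m + 1)) ^ 2) := by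
        simpa using hRg.rename Sum.inl
      have hsum : ∀ {k : ℕ} (e : Fin k → Fin n ⊕ Fin (m + 1)) (A : Finset (Fin k)),
          IsSOS (∑ i ∈ A, X (R := ℝ) (e i) ^ 2) := fun e A =>
        isSOS_iff_isSumSq.2 (IsSumSq.sum fun i _ => (IsSquare.sq (X (e i))).isSumSq)
      rintro (i | i)
      · refine ⟨_, (hball.add (hsum Sum.inl (Finset.univ.erase i)).inQM).add
          (IsSOS.C zero_le_one).inQM, ?_⟩
        rw [← Finset.add_sum_erase _ _ (Finset.mem_univ i)]
        convert zero_mem (Ideal.span (Set.range (h t))) using 1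
        rw [map_add, map_one]
        ring
      · refine ⟨_, (IsSOS.C hR.le).inQM.add (hsum Sum.inr (Finset.univ.erase i)).inQM, ?_⟩
        have : h t (.inl (.inr (.inr ()))) ∈ Ideal.span (Set.range (h t)) :=
          Ideal.subset_span (Set.mem_range_self _)
        convert this using 1
        change _ = 1 - ∑ j, X (Sum.inr j) ^ 2
        rw [← Finset.add_sum_erase _ _ (Finset.mem_univ i), map_add, map_one]
        ring
  intro K hadd hsos hmul hcert
  obtain ⟨q, hqK, hq⟩ := exists_interpolation K hadd hsos hmul (rename Sum.inl f)
    (finite_image_VFJplus f g hfin) ((fun p => Sum.elim p.1 p.2) '' VFJplus f g)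
    (by
      rintro _ ⟨p, hp, rfl⟩
      exact ⟨p, hp, (eval_elim_rename_inl _ _ _).symm⟩)
    (by
      intro t ht
      obtain ⟨p, hp, hmem⟩ := hcert t ht
      refine ⟨p, hp, ?_⟩
      rintro _ ⟨z, hz, rfl⟩ hzt
      have hle : Ideal.span (Set.range (h t)) ≤ RingHom.ker (eval (Sum.elim z.1 z.2)) := by
        rw [Ideal.span_le]
        rintro _ ⟨k | k, rfl⟩
        · exact (mem_VFJplus_iff f g z).1 hz k
        · simpa [h, sub_eq_zero] using hzt
      have := hle hmem
      rw [RingHom.mem_ker, map_add, map_one] at this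
      linarith)
  exact ⟨q, hqK, fun p hp => hq _ ⟨p, hp, rfl⟩⟩
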